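/- Given κ > 0, there exists ε₀ > 0 such that for all ε ∈ (0, ε₀] and all H ≥ 0, the following two statements are equivalent: (A) E_gs(κ, H, ε) < 0 (equivalently, every Ginzburg–Landau minimizer is non-trivial, so a non-trivial critical point exists); (B) λ(ε, H) < κ². -/

import Mathlib

open MeasureTheory Real Set

noncomputable section

/-- The thin tubular neighbourhood `Ω_ε = {x ∈ Ω : dist(x, ∂Ω) < ε}`. -/
def OmegaEps (Ω : Set (ℝ × ℝ)) (ε : ℝ) : Set (ℝ × ℝ) :=
  {x | x ∈ Ω ∧ Metric.infDist x (frontier Ω) < ε}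

/-- `M` is a `C²`, `2L`-periodic, unit-speed parameterization of `∂Ω`,
injective on a period. -/
def BoundaryParam (Ω : Set (ℝ × ℝ)) (L : ℝ) (M : ℝ → ℝ × ℝ) : Prop :=
  ContDiff ℝ 2 M ∧ Function.Periodic M (2 * L) ∧
  (∀ s : ℝ, (deriv M s).1 ^ 2 + (deriv M s).2 ^ 2 = 1) ∧
  Set.InjOn M (Set.Ico 0 (2 * L)) ∧ Set.range M = frontier Ω

/-- The scalar curl `∂₁A₂ − ∂₂A₁` of a planar vector field. -/
def curl2 (A : ℝ × ℝ → ℝ × ℝ) (x : ℝ × ℝ) : ℝ :=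
  fderiv ℝ (fun y => (A y).2) x (1, 0) - fderiv ℝ (fun y => (A y).1) x (0, 1)

/-- `f` is `C¹` on an open neighbourhood of the closure of `S`. -/
def C1Nhd {E : Type*} [NormedAddCommGroup E] [NormedSpace ℝ E]
    (f : ℝ × ℝ → E) (S : Set (ℝ × ℝ)) : Prop :=
  ∃ U : Set (ℝ × ℝ), IsOpen U ∧ closure S ⊆ U ∧ ContDiffOn ℝ 1 f U

/-- The pointwise squared magnetic gradient `|(∇ − i b A)u|²`. -/
def mgNormSq (b : ℝ) (A : ℝ × ℝ → ℝ × ℝ) (u : ℝ × ℝ → ℂ) (x : ℝ × ℝ) : ℝ :=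
  ‖fderiv ℝ u x (1, 0) - Complex.I * (b : ℂ) * ((A x).1 : ℂ) * u x‖ ^ 2 +
  ‖fderiv ℝ u x (0, 1) - Complex.I * (b : ℂ) * ((A x).2 : ℂ) * u x‖ ^ 2

/-- The lowest magnetic Neumann eigenvalue of `−(∇ − i b A)²` on `Ω_ε`,
characterized variationally as the infimum of Rayleigh quotients. -/
def lam (Ω : Set (ℝ × ℝ)) (A : ℝ × ℝ → ℝ × ℝ) (ε b : ℝ) : ℝ :=
  sInf { r : ℝ | ∃ u : ℝ × ℝ → ℂ, C1Nhd u (OmegaEps Ω ε) ∧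
    (0 < ∫ x in OmegaEps Ω ε, ‖u x‖ ^ 2) ∧
    r = (∫ x in OmegaEps Ω ε, mgNormSq b A u x) /
        (∫ x in OmegaEps Ω ε, ‖u x‖ ^ 2) }

/-- The circulation `γ₀ = |Ω| / |∂Ω|` with `|∂Ω| = 2L`. -/
def gamma0 (Ω : Set (ℝ × ℝ)) (L : ℝ) : ℝ := (volume Ω).toReal / (2 * L)

/-- `i₀(c, a, ε) = inf_{n ∈ ℤ} |n + (L/π)(γ₀(a/ε + c) + a/2)|`. -/
def i0 (L γ₀ c a ε : ℝ) : ℝ :=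
  ⨅ n : ℤ, |(n : ℝ) + (L / π) * (γ₀ * (a / ε + c) + a / 2)|

/-- `e₀(c, a, ε) = a²/12 + (π i₀/L)²`. -/
def e0 (L γ₀ c a ε : ℝ) : ℝ :=
  a ^ 2 / 12 + (π * i0 L γ₀ c a ε / L) ^ 2

/-- The Ginzburg–Landau energy of the pair `(ψ, A')`. -/
def GLenergy (Ω : Set (ℝ × ℝ)) (κ H ε : ℝ) (ψ : ℝ × ℝ → ℂ)
    (A' : ℝ × ℝ → ℝ × ℝ) : ℝ :=
  (∫ x in OmegaEps Ω ε,
      (mgNormSq H A' ψ x - κ ^ 2 * ‖ψ x‖ ^ 2 + κ ^ 2 / 2 * ‖ψ x‖ ^ 4)) +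
  H ^ 2 * ∫ x in Ω, (curl2 A' x - 1) ^ 2

/-- Admissible Ginzburg–Landau configurations. -/
def GLadm (Ω : Set (ℝ × ℝ)) (ε : ℝ) (ψ : ℝ × ℝ → ℂ)
    (A' : ℝ × ℝ → ℝ × ℝ) : Prop :=
  C1Nhd ψ (OmegaEps Ω ε) ∧ C1Nhd A' Ω

/-- The Ginzburg–Landau ground-state energy. -/
def Egs (Ω : Set (ℝ × ℝ)) (κ H ε : ℝ) : ℝ :=
  sInf { E : ℝ | ∃ ψ A', GLadm Ω ε ψ A' ∧ E = GLenergy Ω κ H ε ψ A' }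


lemma per_inj (L : ℝ) (hL : 0 < L) (M : ℝ → ℝ × ℝ) (hp : Function.Periodic M (2 * L))
    (hi : Set.InjOn M (Set.Ico 0 (2 * L))) {s t : ℝ} (h : M s = M t) :
    ∃ n : ℤ, s - t = n * (2 * L) := by
  have h2 : (0:ℝ) < 2 * L := by linarith
  have a1 := toIcoMod_mem_Ico h2 0 s
  have a2 := toIcoMod_mem_Ico h2 0 t
  rw [zero_add] at a1 a2
  have e : ∀ u, M (toIcoMod h2 0 u) = M u := by
    intro u
    rw [toIcoMod]
    exact hp.sub_zsmul_eq _
  have := hi a1 a2 (by rw [e, e, h])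
  refine ⟨toIcoDiv h2 0 s - toIcoDiv h2 0 t, ?_⟩
  have b1 := toIcoMod_add_toIcoDiv_zsmul h2 0 s
  have b2 := toIcoMod_add_toIcoDiv_zsmul h2 0 t
  simp only [zsmul_eq_mul] at b1 b2
  push_cast
  linear_combination this - b1 + b2

/-- rotation-type linear equivalence -/
noncomputable def rotEquiv (m1 m2 : ℝ) (h : m1 ^ 2 + m2 ^ 2 = 1) : (ℝ × ℝ) ≃L[ℝ] (ℝ × ℝ) :=
  LinearEquiv.toContinuousLinearEquiv
  { toFun := fun p => (p.1 * m1 - p.2 * m2, p.1 * m2 + p.2 * m1)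
    invFun := fun p => (p.1 * m1 + p.2 * m2, p.2 * m1 - p.1 * m2)
    map_add' := by intro x y; ext <;> simp <;> ring
    map_smul' := by intro c x; ext <;> simp <;> ring
    left_inv := by
      intro x
      ext
      · simp; linear_combination x.1 * h
      · simp; linear_combination x.2 * h
    right_inv := by
      intro x
      ext
      · simp; linear_combination x.1 * h
      · simp; linear_combination x.2 * h }

lemma local_struct (L : ℝ) (hL : 0 < L) (M : ℝ → ℝ × ℝ) (hc : ContDiff ℝ 1 M)
    (hp : Function.Periodic M (2 * L))
    (hd : ∀ s : ℝ, (deriv M s).1 ^ 2 + (deriv M s).2 ^ 2 = 1)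
    (hi : Set.InjOn M (Set.Ico 0 (2 * L))) (s0 : ℝ) :
    ∃ N P Q : Set (ℝ × ℝ), IsOpen N ∧ M s0 ∈ N ∧ IsPreconnected P ∧ IsPreconnected Q ∧
      N \ range M ⊆ P ∪ Q ∧ P ⊆ (range M)ᶜ ∧ Q ⊆ (range M)ᶜ ∧
      N ∩ range M ⊆ closure P ∧ N ∩ range M ⊆ closure Q := by
  set m := deriv M s0 with hm
  set F : ℝ × ℝ → ℝ × ℝ := fun p => M (s0 + p.1) + p.2 • ((-m.2, m.1) : ℝ × ℝ) with hF
  have hF0 : F 0 = M s0 := by simp [hF]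
  have hFc : Continuous F := by
    have := hc.continuous
    fun_prop
  have hFd : HasStrictFDerivAt F ((rotEquiv m.1 m.2 (hd s0) : (ℝ × ℝ) ≃L[ℝ] (ℝ × ℝ)) :
      (ℝ × ℝ) →L[ℝ] (ℝ × ℝ)) 0 := by
    have h1 : HasStrictDerivAt M m s0 := (hc.contDiffAt).hasStrictDerivAt (by norm_num)
    have h2 : HasStrictFDerivAt (fun p : ℝ × ℝ => s0 + p.1) (ContinuousLinearMap.fst ℝ ℝ ℝ)
        (0 : ℝ × ℝ) := (ContinuousLinearMap.fst ℝ ℝ ℝ).hasStrictFDerivAt.const_add s0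
    have h1' : HasStrictDerivAt M m (s0 + (0 : ℝ × ℝ).1) := by simpa using h1
    have h3 := h1'.hasStrictFDerivAt.comp (0 : ℝ × ℝ) h2
    have h4 : HasStrictFDerivAt (fun p : ℝ × ℝ => p.2 • ((-m.2, m.1) : ℝ × ℝ))
        ((ContinuousLinearMap.snd ℝ ℝ ℝ).smulRight ((-m.2, m.1) : ℝ × ℝ)) 0 :=
      ((ContinuousLinearMap.snd ℝ ℝ ℝ).smulRight ((-m.2, m.1) : ℝ × ℝ)).hasStrictFDerivAt
    have h5 := h3.add h4
    refine h5.congr_fderiv ?_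
    ext <;> simp [rotEquiv]
  set e := hFd.toOpenPartialHomeomorph F with he
  have hesrc : (0 : ℝ × ℝ) ∈ e.source := hFd.mem_toOpenPartialHomeomorph_source
  obtain ⟨r0, hr0, hr0s⟩ := Metric.isOpen_iff.1 e.open_source 0 hesrc
  set r := min r0 (L / 2) with hr
  have hrpos : 0 < r := lt_min hr0 (by linarith)
  have hrL : r < L := lt_of_le_of_lt (min_le_right _ _) (by linarith)
  have hrs : Metric.ball (0 : ℝ × ℝ) r ⊆ e.source :=
    (Metric.ball_subset_ball (min_le_left _ _)).trans hr0s
  have hinj : Set.InjOn F (Metric.ball (0 : ℝ × ℝ) r) := by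
    have := e.injOn.mono hrs
    simpa [he] using this
  set K := M '' Icc (s0 + r) (s0 + 2 * L - r) with hK
  have hKc : IsClosed K := (isCompact_Icc.image hc.continuous).isClosed
  have h0K : (0 : ℝ × ℝ) ∈ F ⁻¹' Kᶜ := by
    simp only [mem_preimage, hF0, mem_compl_iff]
    rintro ⟨s, hs, hs'⟩
    obtain ⟨n, hn⟩ := per_inj L hL M hp hi hs'
    have h1 : (0:ℝ) < n * (2 * L) := by rw [← hn]; linarith [hs.1]
    have h2 : n * (2 * L) < 1 * (2 * L) := by rw [← hn]; linarith [hs.2]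
    have h3 : (0:ℝ) < n := by
      by_contra hh
      push Not at hh
      nlinarith
    have h4 : (n:ℝ) < 1 := lt_of_mul_lt_mul_right h2 (by linarith)
    have h3' : (0:ℤ) < n := by exact_mod_cast h3
    have h4' : (n:ℤ) < 1 := by exact_mod_cast h4
    omega
  obtain ⟨r2, hr2, hr2s⟩ := Metric.isOpen_iff.1 (hKc.isOpen_compl.preimage hFc) 0 h0K
  set r1 := min r r2 with hr1
  have hr1pos : 0 < r1 := lt_min hrpos hr2
  have hb1 : Metric.ball (0 : ℝ × ℝ) r1 ⊆ Metric.ball (0 : ℝ × ℝ) r :=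
    Metric.ball_subset_ball (min_le_left _ _)
  have key : ∀ q ∈ Metric.ball (0 : ℝ × ℝ) r1, (F q ∈ range M ↔ q.2 = 0) := by
    intro q hq
    constructor
    · rintro ⟨s, hs⟩
      obtain ⟨s', hs', hss⟩ := hp.exists_mem_Ioc (by linarith : (0:ℝ) < 2 * L) s (s0 - r)
      have hqK : F q ∉ K := hr2s (Metric.ball_subset_ball (min_le_right _ _) hq)
      have hs2 : s' < s0 + r := by
        by_contra hcon
        push Not at hcon
        apply hqK
        rw [← hs, hss]
        exact ⟨s', ⟨hcon, by linarith [hs'.2]⟩, rfl⟩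
      have hmem : ((s' - s0, 0) : ℝ × ℝ) ∈ Metric.ball (0 : ℝ × ℝ) r := by
        simp only [mem_ball_zero_iff, Prod.norm_def, norm_zero, Real.norm_eq_abs]
        refine max_lt ?_ hrpos
        rw [abs_lt]
        constructor <;> linarith [hs'.1]
      have : F q = F (s' - s0, 0) := by
        rw [← hs, hss]; simp [hF]
      have := hinj (hb1 hq) hmem this
      rw [this]
    · intro h
      exact ⟨s0 + q.1, by simp [hF, h]⟩
  have hcl : ∀ σ : ℝ, σ ^ 2 = 1 → ∀ q ∈ Metric.ball (0 : ℝ × ℝ) r1, q.2 = 0 →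
      F q ∈ closure (F '' (Metric.ball (0 : ℝ × ℝ) r1 ∩ {q | 0 < σ * q.2})) := by
    intro σ hσ q hq hq2
    apply image_closure_subset_closure_image hFc
    refine mem_image_of_mem F ?_
    rw [Metric.mem_closure_iff]
    intro δ hδ
    rw [mem_ball_zero_iff, Prod.norm_def, max_lt_iff] at hq
    have hσ1 : |σ| = 1 := by
      have : |σ| ^ 2 = 1 := by rw [sq_abs]; exact hσ
      have h0 := abs_nonneg σ
      nlinarith
    set d := min (δ / 2) (r1 / 2) with hd
    have hd0 : 0 < d := lt_min (by linarith) (by linarith)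
    have hd1 : d < δ := lt_of_le_of_lt (min_le_left _ _) (by linarith)
    have hd2 : d < r1 := lt_of_le_of_lt (min_le_right _ _) (by linarith)
    refine ⟨(q.1, σ * d), ⟨?_, ?_⟩, ?_⟩
    · rw [mem_ball_zero_iff, Prod.norm_def]
      refine max_lt hq.1 ?_
      simp only [Real.norm_eq_abs, abs_mul, hσ1, abs_of_pos hd0]
      linarith
    · simp only [mem_ofPred_eq]
      have : σ * (σ * d) = d := by linear_combination d * hσ
      rw [this]; exact hd0
    · rw [Prod.dist_eq]
      simp only [dist_self, hq2, Real.dist_eq, zero_sub, abs_neg, abs_mul, hσ1, abs_of_pos hd0]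
      simpa using ⟨hδ, hd1⟩
  have hpc : ∀ σ : ℝ, IsPreconnected (F '' (Metric.ball (0 : ℝ × ℝ) r1 ∩ {q | 0 < σ * q.2})) := by
    intro σ
    apply IsPreconnected.image _ _ hFc.continuousOn
    apply Convex.isPreconnected
    apply (convex_ball _ _).inter
    have : {q : ℝ × ℝ | 0 < σ * q.2} = {q : ℝ × ℝ | 0 < (σ • (LinearMap.snd ℝ ℝ ℝ)) q} := by
      ext; simp
    rw [this]
    exact convex_halfSpace_gt (LinearMap.isLinear _) 0
  have hout : ∀ σ : ℝ, F '' (Metric.ball (0 : ℝ × ℝ) r1 ∩ {q | 0 < σ * q.2}) ⊆ (range M)ᶜ := by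
    rintro σ _ ⟨q, ⟨hq, hq2⟩, rfl⟩ hmem
    rw [key q hq] at hmem
    simp [hmem] at hq2
  refine ⟨F '' Metric.ball (0 : ℝ × ℝ) r1, F '' (Metric.ball (0 : ℝ × ℝ) r1 ∩ {q | 0 < 1 * q.2}),
    F '' (Metric.ball (0 : ℝ × ℝ) r1 ∩ {q | 0 < (-1) * q.2}), ?_, ?_, hpc _, hpc _, ?_, hout _,
    hout _, ?_, ?_⟩
  · have := e.isOpen_image_of_subset_source Metric.isOpen_ball (hb1.trans hrs)
    simpa [he] using this
  · exact ⟨0, Metric.mem_ball_self hr1pos, hF0⟩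
  · rintro _ ⟨⟨q, hq, rfl⟩, hn⟩
    rw [key q hq] at hn
    rcases lt_or_gt_of_ne hn with h | h
    · right; exact ⟨q, ⟨hq, by simp [h]⟩, rfl⟩
    · left; exact ⟨q, ⟨hq, by simp [h]⟩, rfl⟩
  · rintro _ ⟨⟨q, hq, rfl⟩, hn⟩
    exact hcl 1 (by norm_num) q hq ((key q hq).1 hn)
  · rintro _ ⟨⟨q, hq, rfl⟩, hn⟩
    exact hcl (-1) (by norm_num) q hq ((key q hq).1 hn)

/-- Three disjoint nonempty open sets cannot partition the complement of the curve. -/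
lemma no_three (L : ℝ) (hL : 0 < L) (M : ℝ → ℝ × ℝ) (hc : ContDiff ℝ 1 M)
    (hp : Function.Periodic M (2 * L))
    (hd : ∀ s : ℝ, (deriv M s).1 ^ 2 + (deriv M s).2 ^ 2 = 1)
    (hi : Set.InjOn M (Set.Ico 0 (2 * L))) (O : Fin 3 → Set (ℝ × ℝ))
    (ho : ∀ i, IsOpen (O i)) (hne : ∀ i, (O i).Nonempty)
    (hdis : ∀ i j, i ≠ j → Disjoint (O i) (O j)) (hcov : (⋃ i, O i) = (range M)ᶜ) : False := by
  have hsub : ∀ i, O i ⊆ (range M)ᶜ := fun i => hcov ▸ subset_iUnion O i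
  have conn : ∀ i, ∀ P : Set (ℝ × ℝ), IsPreconnected P → P ⊆ (range M)ᶜ → (P ∩ O i).Nonempty →
      P ⊆ O i := by
    intro i P hP hPM hPi
    have hV : IsOpen (⋃ j ∈ {j | j ≠ i}, O j) := isOpen_biUnion fun j _ => ho j
    refine hP.subset_left_of_subset_union (ho i) hV ?_ ?_ hPi
    · simp only [disjoint_iUnion_right]
      intro j hj
      exact hdis i j (Ne.symm hj)
    · intro x hx
      have hx' := hPM hx
      rw [← hcov, mem_iUnion] at hx'
      obtain ⟨j, hj⟩ := hx'
      by_cases h : j = i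
      · left; exact h ▸ hj
      · right; exact mem_biUnion h hj
  have hcl : ∀ i, ∀ s, M s ∈ closure (O i) := by
    intro i
    have hset : IsClopen {s : ℝ | M s ∈ closure (O i)} := by
      refine ⟨isClosed_closure.preimage hc.continuous, ?_⟩
      rw [isOpen_iff_mem_nhds]
      intro s hs
      obtain ⟨N, P, Q, hN, hsN, hP, hQ, hPQ, hPM, hQM, hcP, hcQ⟩ :=
        local_struct L hL M hc hp hd hi s
      obtain ⟨x, hxN, hxO⟩ := mem_closure_iff.1 hs N hN hsN
      have : ∃ P', IsPreconnected P' ∧ P' ⊆ (range M)ᶜ ∧ N ∩ range M ⊆ closure P' ∧ x ∈ P' := by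
        rcases hPQ ⟨hxN, hsub i hxO⟩ with h | h
        · exact ⟨P, hP, hPM, hcP, h⟩
        · exact ⟨Q, hQ, hQM, hcQ, h⟩
      obtain ⟨P', h1, h2, h3, h4⟩ := this
      have h5 := conn i P' h1 h2 ⟨x, h4, hxO⟩
      filter_upwards [(hN.preimage hc.continuous).mem_nhds hsN] with t ht
      exact closure_mono h5 (h3 ⟨ht, mem_range_self t⟩)
    rcases isClopen_iff.1 hset with h | h
    · exfalso
      have hclosed : IsClosed (O i) := by
        rw [← closure_subset_iff_isClosed]
        intro x hx
        by_cases hxM : x ∈ range M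
        · obtain ⟨s, rfl⟩ := hxM
          have : s ∈ {s : ℝ | M s ∈ closure (O i)} := hx
          rw [h] at this
          exact absurd this (notMem_empty s)
        · have hx' : x ∈ (range M)ᶜ := hxM
          rw [← hcov, mem_iUnion] at hx'
          obtain ⟨j, hj⟩ := hx'
          by_cases hji : j = i
          · exact hji ▸ hj
          · exfalso
            obtain ⟨y, hy1, hy2⟩ := mem_closure_iff.1 hx (O j) (ho j) hj
            exact (Set.disjoint_left.1 (hdis j i hji)) hy1 hy2
      rcases isClopen_iff.1 ⟨hclosed, ho i⟩ with h' | h'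
      · exact (hne i).ne_empty h'
      · have : M 0 ∈ O i := by rw [h']; trivial
        exact hsub i this (mem_range_self 0)
    · intro s
      have : s ∈ {s : ℝ | M s ∈ closure (O i)} := by rw [h]; trivial
      exact this
  obtain ⟨N, P, Q, hN, hsN, hP, hQ, hPQ, hPM, hQM, hcP, hcQ⟩ :=
    local_struct L hL M hc hp hd hi 0
  have hch : ∀ i, P ∩ O i ≠ ∅ ∨ Q ∩ O i ≠ ∅ := by
    intro i
    obtain ⟨x, hxN, hxO⟩ := mem_closure_iff.1 (hcl i 0) N hN hsN
    rcases hPQ ⟨hxN, hsub i hxO⟩ with h | h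
    · left; exact (Set.Nonempty.ne_empty ⟨x, h, hxO⟩)
    · right; exact (Set.Nonempty.ne_empty ⟨x, h, hxO⟩)
  have uniq : ∀ P' : Set (ℝ × ℝ), IsPreconnected P' → P' ⊆ (range M)ᶜ → ∀ i j, P' ∩ O i ≠ ∅ →
      P' ∩ O j ≠ ∅ → i = j := by
    intro P' h1 h2 i j hi hj
    by_contra hij
    have a := conn i P' h1 h2 (nonempty_iff_ne_empty.2 hi)
    obtain ⟨x, hx1, hx2⟩ := nonempty_iff_ne_empty.2 hj
    exact (Set.disjoint_left.1 (hdis i j hij)) (a hx1) hx2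
  have u1 := uniq P hP hPM
  have u2 := uniq Q hQ hQM
  have c0 := hch 0
  have c1 := hch 1
  have c2 := hch 2
  have n01 : (0 : Fin 3) ≠ 1 := by decide
  have n02 : (0 : Fin 3) ≠ 2 := by decide
  have n12 : (1 : Fin 3) ≠ 2 := by decide
  rcases c0 with c0 | c0 <;> rcases c1 with c1 | c1 <;> rcases c2 with c2 | c2
  · exact n01 (u1 _ _ c0 c1)
  · exact n01 (u1 _ _ c0 c1)
  · exact n02 (u1 _ _ c0 c2)
  · exact n12 (u2 _ _ c1 c2)
  · exact n12 (u1 _ _ c1 c2)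
  · exact n02 (u2 _ _ c0 c2)
  · exact n01 (u2 _ _ c0 c1)
  · exact n01 (u2 _ _ c0 c1)

lemma range_null (M : ℝ → ℝ × ℝ) (hc : ContDiff ℝ 1 M) : volume (range M) = 0 := by
  have h : range M = (fun p : ℝ × ℝ => M p.1) '' (univ ×ˢ {0}) := by
    ext x
    constructor
    · rintro ⟨s, rfl⟩; exact ⟨(s, 0), by simp, rfl⟩
    · rintro ⟨p, -, rfl⟩; exact mem_range_self _
  rw [h]
  apply addHaar_image_eq_zero_of_differentiableOn_of_addHaar_eq_zero
  · have : Differentiable ℝ M := hc.differentiable (by norm_num)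
    exact (this.comp differentiable_fst).differentiableOn
  · rw [Measure.volume_eq_prod, Measure.prod_prod]; simp


/-- partial antiderivative in the first variable -/
noncomputable def TT (g : ℝ × ℝ → ℝ) (p : ℝ × ℝ) : ℝ :=
  ∫ t, (Iic p.1).indicator (fun t => g (t, p.2)) t

lemma TT_kernel_meas (g : ℝ × ℝ → ℝ) (hg : Measurable g) :
    Measurable (fun z : (ℝ × ℝ) × ℝ => (Iic z.1.1).indicator (fun t => g (t, z.1.2)) z.2) := by
  have : (fun z : (ℝ × ℝ) × ℝ => (Iic z.1.1).indicator (fun t => g (t, z.1.2)) z.2) =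
      {z : (ℝ × ℝ) × ℝ | z.2 ≤ z.1.1}.indicator (fun z => g (z.2, z.1.2)) := by
    ext z
    by_cases h : z.2 ≤ z.1.1 <;> simp [indicator, h]
  rw [this]
  apply Measurable.indicator
  · fun_prop
  · exact measurableSet_le (by fun_prop) (by fun_prop)

lemma TT_meas (g : ℝ × ℝ → ℝ) (hg : Measurable g) : StronglyMeasurable (TT g) :=
  (TT_kernel_meas g hg).stronglyMeasurable.integral_prod_right

lemma TT_bound (g : ℝ × ℝ → ℝ) (hi : Integrable g) :
    ∀ᵐ p : ℝ × ℝ, |TT g p| ≤ ∫ t, |g (t, p.2)| := by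
  rw [Measure.volume_eq_prod] at hi
  have h1 := hi.prod_left_ae
  have h2 : ∀ᵐ p : ℝ × ℝ, Integrable (fun x => g (x, p.2)) := by
    rw [Measure.volume_eq_prod]
    exact Measure.quasiMeasurePreserving_snd.ae h1
  filter_upwards [h2] with p hp
  refine (abs_integral_le_integral_abs).trans ?_
  apply integral_mono (hp.indicator measurableSet_Iic).abs hp.abs
  intro t
  by_cases h : t ≤ p.1 <;> simp [indicator, h]

lemma TT_locInt (g : ℝ × ℝ → ℝ) (hg : Measurable g) (hi : Integrable g) :
    LocallyIntegrable (TT g) := by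
  intro x
  refine ⟨Metric.ball x.1 1 ×ˢ univ, ?_, ?_⟩
  · exact prod_mem_nhds (Metric.ball_mem_nhds _ one_pos) Filter.univ_mem
  · have hG : Integrable (fun y => ∫ t, ‖g (t, y)‖) := by
      rw [Measure.volume_eq_prod] at hi
      exact hi.integral_norm_prod_right
    have h1 : IntegrableOn (fun p : ℝ × ℝ => (fun _ : ℝ => (1:ℝ)) p.1 * (fun y => ∫ t, ‖g (t, y)‖) p.2)
        (Metric.ball x.1 1 ×ˢ univ) := by
      rw [IntegrableOn, Measure.volume_eq_prod, ← Measure.prod_restrict, Measure.restrict_univ]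
      refine Integrable.mul_prod (f := fun _ : ℝ => (1:ℝ)) (g := fun y => ∫ t, ‖g (t, y)‖) ?_ hG
      rw [integrable_const_iff]
      right
      constructor
      simp [Real.volume_ball]
    refine Integrable.mono' h1 (TT_meas g hg).aestronglyMeasurable ?_
    filter_upwards [ae_restrict_of_ae (TT_bound g hi)] with p hp
    simpa using hp

lemma TT_pair (g : ℝ × ℝ → ℝ) (hg : Measurable g) (hi : Integrable g) (θ : ℝ × ℝ → ℝ)
    (hθ : Continuous θ) (hc : HasCompactSupport θ) :
    ∫ p, θ p * TT g p = ∫ p, g p * ∫ x in Ioi p.1, θ (x, p.2) := by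
  set K : ℝ → (ℝ × ℝ) → ℝ := fun x q => θ (x, q.2) * (Iic x).indicator (fun t => g (t, q.2)) q.1
    with hK
  obtain ⟨C, hC⟩ := hc.exists_bound_of_continuous hθ
  obtain ⟨R, hR⟩ := hc.isCompact.isBounded.subset_closedBall 0
  have hz : ∀ x y, x ∉ Icc (-R) R → θ (x, y) = 0 := by
    intro x y hx
    by_contra h
    apply hx
    have := hR (subset_tsupport θ h)
    rw [mem_closedBall_zero_iff, Prod.norm_def, max_le_iff] at this
    exact abs_le.1 this.1
  have hC0 : 0 ≤ C := (norm_nonneg _).trans (hC 0)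
  have hKi : Integrable (Function.uncurry K) (volume.prod volume) := by
    have h1 : Integrable (fun z : ℝ × (ℝ × ℝ) => (Icc (-R) R).indicator (fun _ => C) z.1 * ‖g z.2‖)
        (volume.prod volume) := by
      apply Integrable.mul_prod (f := (Icc (-R) R).indicator (fun _ => C)) (g := fun q => ‖g q‖)
      · rw [integrable_indicator_iff measurableSet_Icc]
        exact integrableOn_const (by simp)
      · exact hi.norm
    refine h1.mono' ?_ (Filter.Eventually.of_forall ?_)
    · apply Measurable.aestronglyMeasurable
      have := (TT_kernel_meas g hg).comp
        (show Measurable (fun z : ℝ × (ℝ × ℝ) => (((z.1, z.2.2), z.2.1) : (ℝ × ℝ) × ℝ)) by fun_prop)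
      have hm := hθ.measurable
      have h2 : Measurable (fun z : ℝ × (ℝ × ℝ) => θ (z.1, z.2.2)) := by fun_prop
      exact h2.mul this
    · rintro ⟨x, t, y⟩
      simp only [Function.uncurry, hK, norm_mul]
      by_cases hx : x ∈ Icc (-R) R
      · rw [indicator_of_mem hx]
        gcongr
        · exact hC _
        · by_cases h : t ≤ x <;> simp [indicator, h]
      · rw [hz x y hx]; simp [hx]
  have hL : Integrable (fun p => θ p * TT g p) := by
    simpa using (TT_locInt g hg hi).integrable_smul_left_of_hasCompactSupport hθ hc
  have e1 : ∫ p, θ p * TT g p = ∫ x, ∫ q, K x q := by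
    rw [Measure.volume_eq_prod] at hL ⊢
    rw [integral_prod _ hL]
    apply integral_congr_ae
    filter_upwards [hKi.prod_right_ae] with x hx
    simp only [Function.uncurry] at hx
    rw [Measure.volume_eq_prod] at hx
    rw [integral_prod_symm _ hx]
    congr 1
    ext y
    simp only [hK, TT]
    rw [integral_const_mul]
  rw [e1, integral_integral_swap hKi]
  congr 1
  ext ⟨t, y⟩
  simp only [hK]
  rw [← integral_Ici_eq_integral_Ioi, ← integral_indicator measurableSet_Ici, ← integral_const_mul]
  congr 1
  ext x
  by_cases h : t ≤ x <;> simp [indicator, h]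
  ring

lemma integral_shift (k : ℝ → ℝ) (z : ℝ) : ∫ w in Iio 0, k (z - w) = ∫ x in Ioi z, k x := by
  have := (volume.measurePreserving_sub_left z).setIntegral_preimage_emb
    (Homeomorph.subLeft z).measurableEmbedding k (Ioi z)
  rw [← this]
  congr 2
  ext w; simp

lemma slice1 {θ : ℝ × ℝ → ℝ} (hc : HasCompactSupport θ) (y : ℝ) :
    HasCompactSupport (fun x => θ (x, y)) := by
  obtain ⟨R, hR⟩ := hc.isCompact.isBounded.subset_closedBall 0
  refine HasCompactSupport.intro (K := Icc (-R) R) isCompact_Icc ?_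
  intro x hx
  by_contra h
  apply hx
  have := hR (subset_tsupport θ h)
  rw [mem_closedBall_zero_iff, Prod.norm_def, max_le_iff] at this
  exact abs_le.1 this.1

lemma slice2 {θ : ℝ × ℝ → ℝ} (hc : HasCompactSupport θ) (x : ℝ) :
    HasCompactSupport (fun y => θ (x, y)) := by
  obtain ⟨R, hR⟩ := hc.isCompact.isBounded.subset_closedBall 0
  refine HasCompactSupport.intro (K := Icc (-R) R) isCompact_Icc ?_
  intro y hy
  by_contra h
  apply hy
  have := hR (subset_tsupport θ h)
  rw [mem_closedBall_zero_iff, Prod.norm_def, max_le_iff] at this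
  exact abs_le.1 this.2

lemma ftc1 {θ : ℝ × ℝ → ℝ} (hθ : ContDiff ℝ 1 θ) (hc : HasCompactSupport θ) (x y : ℝ) :
    ∫ s in Ioi x, fderiv ℝ θ (s, y) (1, 0) = - θ (x, y) := by
  have h1 : ContDiff ℝ 1 (fun s => θ (s, y)) := by fun_prop
  rw [← (slice1 hc y).integral_Ioi_deriv_eq h1 x]
  congr 1
  ext s
  have h2 : HasDerivAt (fun s : ℝ => ((s, y) : ℝ × ℝ)) (1, 0) s :=
    (hasDerivAt_id s).prodMk (hasDerivAt_const s y)
  exact (((hθ.differentiable one_ne_zero (s, y)).hasFDerivAt.comp_hasDerivAt s h2).deriv).symm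

lemma ftc2 {θ : ℝ × ℝ → ℝ} (hθ : ContDiff ℝ 1 θ) (hc : HasCompactSupport θ) (x y : ℝ) :
    ∫ s in Ioi y, fderiv ℝ θ (x, s) (0, 1) = - θ (x, y) := by
  have h1 : ContDiff ℝ 1 (fun s => θ (x, s)) := by fun_prop
  rw [← (slice2 hc x).integral_Ioi_deriv_eq h1 y]
  congr 1
  ext s
  have h2 : HasDerivAt (fun s : ℝ => ((x, s) : ℝ × ℝ)) (0, 1) s :=
    (hasDerivAt_const s x).prodMk (hasDerivAt_id s)
  exact (((hθ.differentiable one_ne_zero (x, s)).hasFDerivAt.comp_hasDerivAt s h2).deriv).symm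

lemma exists_test (θ : ℝ × ℝ → ℝ) (hθ : ContDiff ℝ 1 θ) (hc : HasCompactSupport θ) :
    ∃ φ : ℝ × ℝ → ℝ, ContDiff ℝ 1 φ ∧
      (∀ p, fderiv ℝ φ p (1, 0) = - ∫ y in Ioi p.2, θ (p.1, y)) ∧
      (∀ p, fderiv ℝ φ p (0, 1) = - ∫ x in Ioi p.1, θ (x, p.2)) := by
  set S : Set (ℝ × ℝ) := Iio 0 ×ˢ Iio 0 with hS
  have hSm : MeasurableSet S := measurableSet_Iio.prod measurableSet_Iio
  set f : ℝ × ℝ → ℝ := S.indicator (fun _ => 1) with hf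
  have hfl : LocallyIntegrable f := (locallyIntegrable_const 1).indicator hSm
  have hder : ∀ p v, fderiv ℝ (convolution f θ (ContinuousLinearMap.lsmul ℝ ℝ) volume) p v =
      ∫ w in S, fderiv ℝ θ (p - w) v := by
    intro p v
    rw [(hc.hasFDerivAt_convolution_right (ContinuousLinearMap.lsmul ℝ ℝ) hfl hθ p).fderiv,
      convolution_precompR_apply _ hfl (hc.fderiv ℝ) (hθ.continuous_fderiv one_ne_zero)]
    simp only [convolution, hf]
    rw [← integral_indicator hSm]
    congr 1
    ext w
    by_cases h : w ∈ S <;> simp [h]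
  have hIntF : ∀ p v, IntegrableOn (fun w => fderiv ℝ θ (p - w) v) S := by
    intro p v
    apply Integrable.integrableOn
    apply Integrable.comp_sub_left (f := fun w => fderiv ℝ θ w v)
    apply Continuous.integrable_of_hasCompactSupport
    · have := hθ.continuous_fderiv one_ne_zero
      fun_prop
    · exact hc.fderiv_apply ℝ v
  refine ⟨convolution f θ (ContinuousLinearMap.lsmul ℝ ℝ) volume,
    hc.contDiff_convolution_right _ hfl hθ, ?_, ?_⟩
  · rintro ⟨x, y⟩
    have hi := hIntF (x, y) (1, 0)
    rw [hder]
    rw [IntegrableOn, Measure.volume_eq_prod, hS, ← Measure.prod_restrict] at hi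
    rw [Measure.volume_eq_prod, hS, ← Measure.prod_restrict, integral_prod_symm _ hi]
    simp only [Prod.mk_sub_mk]
    rw [← integral_shift (fun y => θ (x, y)), ← integral_neg]
    congr 1
    ext w
    rw [integral_shift (fun s => fderiv ℝ θ (s, y - w) (1, 0)), ftc1 hθ hc]
  · rintro ⟨x, y⟩
    have hi := hIntF (x, y) (0, 1)
    rw [hder]
    rw [IntegrableOn, Measure.volume_eq_prod, hS, ← Measure.prod_restrict] at hi
    rw [Measure.volume_eq_prod, hS, ← Measure.prod_restrict, integral_prod _ hi]
    simp only [Prod.mk_sub_mk]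
    rw [← integral_shift (fun x => θ (x, y)), ← integral_neg]
    congr 1
    ext w
    rw [integral_shift (fun s => fderiv ℝ θ (x - w, s) (0, 1)), ftc2 hθ hc]

lemma cs_int {α : Type*} [MeasurableSpace α] {μ : Measure α} (f h : α → ℝ)
    (hf : Integrable (fun x => f x ^ 2) μ) (hh : Integrable (fun x => h x ^ 2) μ)
    (hfh : Integrable (fun x => f x * h x) μ) :
    (∫ x, f x * h x ∂μ) ^ 2 ≤ (∫ x, f x ^ 2 ∂μ) * ∫ x, h x ^ 2 ∂μ := by
  have key : ∀ t : ℝ, 0 ≤ (∫ x, f x ^ 2 ∂μ) * (t * t) + (2 * ∫ x, f x * h x ∂μ) * t +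
      ∫ x, h x ^ 2 ∂μ := by
    intro t
    have h0 : 0 ≤ ∫ x, (f x * t + h x) ^ 2 ∂μ := integral_nonneg fun x => sq_nonneg _
    have : ∫ x, (f x * t + h x) ^ 2 ∂μ = ∫ x, ((t * t) * f x ^ 2 + (2 * t) * (f x * h x) + h x ^ 2) ∂μ := by
      congr 1; ext x; ring
    have hs : Integrable (fun x => (t * t) * f x ^ 2 + (2 * t) * (f x * h x)) μ :=
      (hf.const_mul _).add (hfh.const_mul _)
    rw [this, integral_add hs hh, integral_add (hf.const_mul _) (hfh.const_mul _), integral_const_mul, integral_const_mul] at h0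
    linarith
  have := discrim_le_zero key
  rw [discrim] at this
  linarith

/-- partial antiderivative in the second variable, with a minus sign -/
noncomputable def TS (g : ℝ × ℝ → ℝ) (p : ℝ × ℝ) : ℝ := - TT (fun q => g q.swap) p.swap

lemma swap_mp : MeasurePreserving (Prod.swap : ℝ × ℝ → ℝ × ℝ) volume volume := by
  rw [Measure.volume_eq_prod]; exact Measure.measurePreserving_swap

lemma swap_int {g : ℝ × ℝ → ℝ} (hi : Integrable g) : Integrable (fun q : ℝ × ℝ => g q.swap) :=
  swap_mp.integrable_comp_of_integrable hi

lemma swap_integral_eq (g : ℝ × ℝ → ℝ) : ∫ q : ℝ × ℝ, g q.swap = ∫ q, g q :=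
  swap_mp.integral_comp (MeasurableEquiv.prodComm (α := ℝ) (β := ℝ)).measurableEmbedding g

lemma TS_pair (g : ℝ × ℝ → ℝ) (hg : Measurable g) (hi : Integrable g) (θ : ℝ × ℝ → ℝ)
    (hθ : Continuous θ) (hc : HasCompactSupport θ) :
    ∫ p, θ p * TS g p = - ∫ p, g p * ∫ y in Ioi p.2, θ (p.1, y) := by
  have h1 := TT_pair (fun q => g q.swap) (hg.comp measurable_swap) (swap_int hi)
    (fun q => θ q.swap) (hθ.comp continuous_swap)
    (hc.comp_homeomorph (Homeomorph.prodComm ℝ ℝ))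
  rw [← swap_integral_eq (fun p => θ p * TS g p), ← swap_integral_eq (fun p => g p * _)]
  simp only [TS, Prod.swap_swap, mul_neg, integral_neg, neg_inj]
  rw [h1]
  rfl

lemma TS_locInt (g : ℝ × ℝ → ℝ) (hg : Measurable g) (hi : Integrable g) :
    LocallyIntegrable (TS g) := by
  have h := TT_locInt (fun q => g q.swap) (hg.comp measurable_swap) (swap_int hi)
  apply LocallyIntegrable.neg
  rw [locallyIntegrable_iff] at h ⊢
  intro k hk
  have hk' : IsCompact (Prod.swap '' k) := hk.image continuous_swap
  have := h _ hk'
  have hme := (MeasurableEquiv.prodComm (α := ℝ) (β := ℝ)).measurableEmbedding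
  have h2 := (swap_mp.integrableOn_comp_preimage (s := Prod.swap '' k) hme).2 this
  have : Prod.swap ⁻¹' (Prod.swap '' k) = k := by
    rw [preimage_image_eq _ Prod.swap_injective]
  rw [this] at h2
  exact h2

lemma TT_eq_TS (g1 g2 : ℝ × ℝ → ℝ) (m1 : Measurable g1) (m2 : Measurable g2)
    (i1 : Integrable g1) (i2 : Integrable g2) (b : Bornology.IsBounded (Function.support g1))
    (b' : Bornology.IsBounded (Function.support g2))
    (hdiv : ∀ φ : ℝ × ℝ → ℝ, ContDiff ℝ 1 φ →
      ∫ p, (g1 p * fderiv ℝ φ p (1, 0) + g2 p * fderiv ℝ φ p (0, 1)) = 0) :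
    ∀ᵐ p : ℝ × ℝ, TT g2 p = TS g1 p := by
  have key := ae_eq_zero_of_integral_contDiff_smul_eq_zero (μ := volume)
    (f := fun p => TT g2 p - TS g1 p) ((TT_locInt g2 m2 i2).sub (TS_locInt g1 m1 i1)) ?_
  · filter_upwards [key] with p hp
    linarith
  intro θ hθ hc
  have hθ1 : ContDiff ℝ 1 θ := hθ.of_le (by exact_mod_cast le_top)
  obtain ⟨φ, hφ, d1, d2⟩ := exists_test θ hθ1 hc
  have e1 := TT_pair g2 m2 i2 θ hθ.continuous hc
  have e2 := TS_pair g1 m1 i1 θ hθ.continuous hc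
  have e3 := hdiv φ hφ
  have cI : ∀ g : ℝ × ℝ → ℝ, Integrable g → Bornology.IsBounded (Function.support g) → ∀ v,
      Integrable (fun p => g p * fderiv ℝ φ p v) := by
    intro g hg hb v
    obtain ⟨R, hR⟩ := hb.subset_closedBall 0
    have hcont : Continuous (fun p => fderiv ℝ φ p v) := by
      have := hφ.continuous_fderiv one_ne_zero
      fun_prop
    have h1 : IntegrableOn (fun p => g p * fderiv ℝ φ p v) (Metric.closedBall 0 R) :=
      hg.integrableOn.mul_continuousOn hcont.continuousOn (isCompact_closedBall _ _)
    rw [← integrableOn_univ]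
    refine h1.of_forall_diff_eq_zero MeasurableSet.univ ?_
    intro x hx
    have : g x = 0 := by
      by_contra h
      exact hx.2 (hR h)
    simp [this]
  rw [integral_add (cI g1 i1 b _) (cI g2 i2 b' _)] at e3
  simp only [d1, d2, mul_neg, integral_neg] at e3
  have I1 : Integrable (fun p => θ p * TT g2 p) := by
    simpa using (TT_locInt g2 m2 i2).integrable_smul_left_of_hasCompactSupport hθ.continuous hc
  have I2 : Integrable (fun p => θ p * TS g1 p) := by
    simpa using (TS_locInt g1 m1 i1).integrable_smul_left_of_hasCompactSupport hθ.continuous hc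
  simp only [smul_eq_mul, mul_sub]
  rw [integral_sub I1 I2, e1, e2]
  linarith

lemma TT_const (g : ℝ × ℝ → ℝ) (x x' y : ℝ) (h : ∀ t ∈ uIcc x x', g (t, y) = 0) :
    TT g (x, y) = TT g (x', y) := by
  simp only [TT]
  congr 1
  ext t
  simp only [indicator, mem_Iic]
  by_cases h1 : t ≤ x <;> by_cases h2 : t ≤ x'
  · simp [h1, h2]
  · simp [h1, h2, h t (by rw [mem_uIcc]; right; constructor <;> linarith)]
  · simp [h1, h2, h t (by rw [mem_uIcc]; left; constructor <;> linarith)]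
  · simp [h1, h2]

lemma const_on_ball (g1 g2 : ℝ × ℝ → ℝ) (hTS : ∀ᵐ p : ℝ × ℝ, TT g2 p = TS g1 p)
    (p : ℝ × ℝ) (r : ℝ) (hr : 0 < r) (h1 : ∀ q ∈ Metric.ball p r, g1 q = 0)
    (h2 : ∀ q ∈ Metric.ball p r, g2 q = 0) :
    ∃ c, ∀ᵐ q : ℝ × ℝ, q ∈ Metric.ball p r → TT g2 q = c := by
  have hmem : ∀ x y, (x, y) ∈ Metric.ball p r ↔ x ∈ Metric.ball p.1 r ∧ y ∈ Metric.ball p.2 r := by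
    intro x y
    rw [← ball_prod_same, mem_prod]
  have hsub : ∀ a x x' t : ℝ, x ∈ Metric.ball a r → x' ∈ Metric.ball a r → t ∈ uIcc x x' →
      t ∈ Metric.ball a r := by
    intro a x x' t hx hx' ht
    exact (convex_ball a r).ordConnected.uIcc_subset hx hx' ht
  have ha : ∀ x y, (x, y) ∈ Metric.ball p r → TT g2 (x, y) = TT g2 (p.1, y) := by
    intro x y hxy
    rw [hmem] at hxy
    apply TT_const
    intro t ht
    apply h2
    rw [hmem]
    exact ⟨hsub _ _ _ _ hxy.1 (Metric.mem_ball_self hr) ht, hxy.2⟩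
  have hb : ∀ x y, (x, y) ∈ Metric.ball p r → TS g1 (x, y) = TS g1 (x, p.2) := by
    intro x y hxy
    rw [hmem] at hxy
    simp only [TS, Prod.swap_prod_mk, neg_inj]
    apply TT_const
    intro t ht
    apply h1
    simp only [Prod.swap_prod_mk]
    rw [hmem]
    exact ⟨hxy.1, hsub _ _ _ _ hxy.2 (Metric.mem_ball_self hr) ht⟩
  rw [Measure.volume_eq_prod] at hTS
  have h3 := Measure.ae_ae_of_ae_prod hTS
  have h4 : ∃ x ∈ Metric.ball p.1 r, ∀ᵐ y, TT g2 (x, y) = TS g1 (x, y) := by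
    by_contra hcon
    have hcon : ∀ x ∈ Metric.ball p.1 r, ¬ ∀ᵐ y, TT g2 (x, y) = TS g1 (x, y) :=
      fun x hx h => hcon ⟨x, hx, h⟩
    have : volume (Metric.ball p.1 r) = 0 := by
      refine measure_mono_null ?_ h3
      intro x hx hx'
      exact hcon x hx hx'
    exact (Metric.measure_ball_pos volume p.1 hr).ne' this
  obtain ⟨x0, hx0, h5⟩ := h4
  refine ⟨TS g1 (x0, p.2), ?_⟩
  have h6 : ∀ᵐ q : ℝ × ℝ, TT g2 (x0, q.2) = TS g1 (x0, q.2) := by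
    rw [Measure.volume_eq_prod]
    exact Measure.quasiMeasurePreserving_snd.ae h5
  filter_upwards [h6] with ⟨x, y⟩ hq hxy
  have hxy' := (hmem x y).1 hxy
  have hx0y : (x0, y) ∈ Metric.ball p r := (hmem _ _).2 ⟨hx0, hxy'.2⟩
  rw [ha x y hxy, ← ha x0 y hx0y, hq, hb x0 y hx0y]

lemma vanish_out (Ω : Set (ℝ × ℝ)) (hΩo : IsOpen Ω) (hΩb : Bornology.IsBounded Ω)
    (hΩn : Ω.Nonempty)
    (L : ℝ) (hL : 0 < L) (M : ℝ → ℝ × ℝ) (hc : ContDiff ℝ 1 M)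
    (hp : Function.Periodic M (2 * L))
    (hd : ∀ s : ℝ, (deriv M s).1 ^ 2 + (deriv M s).2 ^ 2 = 1)
    (hi : Set.InjOn M (Set.Ico 0 (2 * L))) (hr : range M = frontier Ω)
    (g1 g2 : ℝ × ℝ → ℝ) (hTS : ∀ᵐ p : ℝ × ℝ, TT g2 p = TS g1 p)
    (h1 : ∀ q, q ∉ Ω → g1 q = 0) (h2 : ∀ q, q ∉ Ω → g2 q = 0) :
    ∀ᵐ p : ℝ × ℝ, p ∉ Ω → TT g2 p = 0 := by
  set W := (closure Ω)ᶜ with hW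
  have hWo : IsOpen W := isClosed_closure.isOpen_compl
  have hWΩ : ∀ q ∈ W, q ∉ Ω := fun q hq h => hq (subset_closure h)
  set S : Set (ℝ × ℝ) := {p | p ∈ W ∧ ∃ O, IsOpen O ∧ p ∈ O ∧ ∀ᵐ q : ℝ × ℝ, q ∈ O → TT g2 q = 0}
    with hS
  have hSo : IsOpen S := by
    rw [isOpen_iff_mem_nhds]
    rintro p ⟨hpW, O, hO, hpO, hq⟩
    filter_upwards [hWo.mem_nhds hpW, hO.mem_nhds hpO] with x hx hx'
    exact ⟨hx, O, hO, hx', hq⟩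
  have hVo : IsOpen (W \ S) := by
    rw [isOpen_iff_mem_nhds]
    rintro p ⟨hpW, hpS⟩
    obtain ⟨r, hr0, hrW⟩ := Metric.isOpen_iff.1 hWo p hpW
    obtain ⟨c, hcc⟩ := const_on_ball g1 g2 hTS p r hr0 (fun q hq => h1 q (hWΩ q (hrW hq)))
      (fun q hq => h2 q (hWΩ q (hrW hq)))
    filter_upwards [Metric.ball_mem_nhds p hr0] with q hq
    refine ⟨hrW hq, ?_⟩
    rintro ⟨-, O, hO, hqO, hO0⟩
    apply hpS
    have hpos : 0 < volume (O ∩ Metric.ball p r) :=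
      (hO.inter Metric.isOpen_ball).measure_pos volume ⟨q, hqO, hq⟩
    have hc0 : c = 0 := by
      by_contra hne
      have : volume (O ∩ Metric.ball p r) = 0 := by
        have hh : ∀ᵐ q : ℝ × ℝ, q ∉ O ∩ Metric.ball p r := by
          filter_upwards [hO0, hcc] with x hx hx' hxx
          exact hne ((hx' hxx.2).symm.trans (hx hxx.1))
        exact measure_eq_zero_iff_ae_notMem.2 hh
      exact hpos.ne' this
    refine ⟨hpW, Metric.ball p r, Metric.isOpen_ball, Metric.mem_ball_self hr0, ?_⟩
    rw [← hc0]
    exact hcc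
  have hSn : S.Nonempty := by
    obtain ⟨R, hR⟩ := hΩb.subset_closedBall 0
    have hR' : closure Ω ⊆ Metric.closedBall 0 R := closure_minimal hR Metric.isClosed_closedBall
    have hin : ∀ q ∈ Metric.closedBall (0 : ℝ × ℝ) R, -R ≤ q.1 := by
      intro q hq
      rw [mem_closedBall_zero_iff, Prod.norm_def, max_le_iff] at hq
      exact (abs_le.1 hq.1).1
    refine ⟨(-R - 1, 0), ?_, {q | q.1 < -R}, isOpen_lt continuous_fst continuous_const, ?_, ?_⟩
    · intro h
      have := hin _ (hR' h)
      simp only at this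
      linarith
    · simp
    · filter_upwards with q hq
      simp only [TT]
      rw [integral_eq_zero_of_ae]
      filter_upwards with t
      simp only [indicator, mem_Iic, Pi.zero_apply]
      split_ifs with ht
      · apply h2
        intro h
        have := hin _ (hR h)
        have hq' : q.1 < -R := hq
        simp only at this
        linarith
      · rfl
  have hVe : W \ S = ∅ := by
    by_contra hne
    refine no_three L hL M hc hp hd hi ![Ω, S, W \ S] ?_ ?_ ?_ ?_
    · intro i; fin_cases i
      · exact hΩo
      · exact hSo
      · exact hVo
    · intro i; fin_cases i
      · exact hΩn
      · exact hSn
      · exact nonempty_iff_ne_empty.2 hne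
    · have d1 : Disjoint Ω S := by
        rw [Set.disjoint_left]; intro x hx hxS; exact hWΩ x hxS.1 hx
      have d2 : Disjoint Ω (W \ S) := by
        rw [Set.disjoint_left]; intro x hx hxS; exact hWΩ x hxS.1 hx
      have d3 : Disjoint S (W \ S) := disjoint_sdiff_right
      intro i j hij
      fin_cases i <;> fin_cases j <;> simp at hij ⊢ <;>
        first | assumption | (apply Disjoint.symm; assumption)
    · rw [hr]
      ext x
      have hf : frontier Ω = closure Ω \ Ω := hΩo.frontier_eq
      simp only [mem_iUnion, mem_compl_iff, hf]
      constructor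
      · rintro ⟨i, hi⟩ ⟨h3, h4⟩
        fin_cases i
        · exact h4 hi
        · exact hi.1 h3
        · exact hi.1 h3
      · intro h
        by_cases hx : x ∈ Ω
        · exact ⟨0, hx⟩
        · have hxW : x ∈ W := fun h' => h ⟨h', hx⟩
          by_cases hxS : x ∈ S
          · exact ⟨1, hxS⟩
          · exact ⟨2, hxW, hxS⟩
  have hWS : W ⊆ S := by rw [← diff_eq_empty]; exact hVe
  have hnull : volume {q | q ∈ W ∧ TT g2 q ≠ 0} = 0 := by
    apply measure_null_of_locally_null
    intro x hx
    obtain ⟨-, O, hO, hxO, hO0⟩ := hWS hx.1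
    refine ⟨_, inter_mem_nhdsWithin _ (hO.mem_nhds hxO), ?_⟩
    rw [ae_iff] at hO0
    refine measure_mono_null ?_ hO0
    rintro y ⟨hy, hyO⟩
    simp only [mem_ofPred_eq]
    push Not
    exact ⟨hyO, hy.2⟩
  have hΓ : volume (frontier Ω) = 0 := by rw [← hr]; exact range_null M hc
  have a1 : ∀ᵐ p : ℝ × ℝ, ¬ (p ∈ W ∧ TT g2 p ≠ 0) := by
    rw [ae_iff]; simpa using hnull
  have a2 : ∀ᵐ p : ℝ × ℝ, p ∉ frontier Ω := measure_eq_zero_iff_ae_notMem.1 hΓ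
  filter_upwards [a1, a2] with p hp1 hp2 hpΩ
  by_contra hne
  apply hp1
  refine ⟨?_, hne⟩
  intro hcl
  exact hp2 (by rw [hΩo.frontier_eq]; exact ⟨hcl, hpΩ⟩)

lemma cutoff (Ω U : Set (ℝ × ℝ)) (hΩb : Bornology.IsBounded Ω) (hU : IsOpen U)
    (hΩU : closure Ω ⊆ U) (f : ℝ × ℝ → ℝ) (hf : ContDiffOn ℝ 1 f U) :
    ∃ F : ℝ × ℝ → ℝ, ContDiff ℝ 1 F ∧ HasCompactSupport F ∧ ∀ x ∈ closure Ω, F =ᶠ[nhds x] f := by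
  have hcpt : IsCompact (closure Ω) := hΩb.isCompact_closure
  obtain ⟨V, hV, hΩV, hVU, hVc⟩ := exists_open_between_and_isCompact_closure hcpt hU hΩU
  obtain ⟨χ, hχ1, hχ0, -⟩ := exists_contMDiffMap_one_nhds_of_subset_interior
    (n := 1) (modelWithCornersSelf ℝ (ℝ × ℝ)) (s := closure Ω) (t := V) isClosed_closure
    (by rw [hV.interior_eq]; exact hΩV)
  have hχc : ContDiff ℝ 1 χ := χ.contMDiff.contDiff
  refine ⟨fun x => χ x * f x, ?_, ?_, ?_⟩
  · rw [contDiff_iff_contDiffAt]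
    intro x
    by_cases hx : x ∈ U
    · exact hχc.contDiffAt.mul (hf.contDiffAt (hU.mem_nhds hx))
    · have hx' : x ∈ (closure V)ᶜ := fun h => hx (hVU h)
      have : (fun x => χ x * f x) =ᶠ[nhds x] fun _ => 0 := by
        filter_upwards [isClosed_closure.isOpen_compl.mem_nhds hx'] with y hy
        rw [hχ0 y (fun h => hy (subset_closure h)), zero_mul]
      exact contDiffAt_const.congr_of_eventuallyEq this
  · refine HasCompactSupport.intro hVc ?_
    intro x hx
    rw [hχ0 x (fun h => hx (subset_closure h)), zero_mul]
  · intro x hx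
    filter_upwards [hχ1.filter_mono (nhds_le_nhdsSet hx)] with y hy
    rw [hy, one_mul]

lemma core (Ω : Set (ℝ × ℝ)) (hΩo : IsOpen Ω) (hΩb : Bornology.IsBounded Ω)
    (hΩn : Ω.Nonempty)
    (L : ℝ) (hL : 0 < L) (M : ℝ → ℝ × ℝ) (hc : ContDiff ℝ 1 M)
    (hp : Function.Periodic M (2 * L))
    (hd : ∀ s : ℝ, (deriv M s).1 ^ 2 + (deriv M s).2 ^ 2 = 1)
    (hi : Set.InjOn M (Set.Ico 0 (2 * L))) (hr : range M = frontier Ω)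
    (g1 g2 : ℝ × ℝ → ℝ) (m1 : Measurable g1) (m2 : Measurable g2)
    (i1 : Integrable g1) (i2 : Integrable g2)
    (h1 : ∀ q, q ∉ Ω → g1 q = 0) (h2 : ∀ q, q ∉ Ω → g2 q = 0)
    (hdiv : ∀ φ : ℝ × ℝ → ℝ, ContDiff ℝ 1 φ →
      ∫ p, (g1 p * fderiv ℝ φ p (1, 0) + g2 p * fderiv ℝ φ p (0, 1)) = 0)
    (U : Set (ℝ × ℝ)) (hU : IsOpen U) (hΩU : closure Ω ⊆ U) (B : ℝ × ℝ → ℝ × ℝ)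
    (hB : ContDiffOn ℝ 1 B U) :
    (∫ p, ((B p).1 * g1 p + (B p).2 * g2 p)) ^ 2 ≤
      (∫ p in Ω, curl2 B p ^ 2) * ((∫ p, |g1 p|) * ∫ p, |g2 p|) := by
  obtain ⟨B1, B1c, B1s, hB1⟩ := cutoff Ω U hΩb hU hΩU (fun x => (B x).1) hB.fst
  obtain ⟨B2, B2c, B2s, hB2⟩ := cutoff Ω U hΩb hU hΩU (fun x => (B x).2) hB.snd
  have bs1 : Bornology.IsBounded (Function.support g1) := hΩb.subset (fun x hx => by
    by_contra h; exact hx (h1 x h))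
  have bs2 : Bornology.IsBounded (Function.support g2) := hΩb.subset (fun x hx => by
    by_contra h; exact hx (h2 x h))
  have hTS := TT_eq_TS g1 g2 m1 m2 i1 i2 bs1 bs2 hdiv
  have hv := vanish_out Ω hΩo hΩb hΩn L hL M hc hp hd hi hr g1 g2 hTS h1 h2
  have c1 : Continuous (fun p => fderiv ℝ B1 p (0, 1)) := by
    have := B1c.continuous_fderiv one_ne_zero
    fun_prop
  have c2 : Continuous (fun p => fderiv ℝ B2 p (1, 0)) := by
    have := B2c.continuous_fderiv one_ne_zero
    fun_prop
  have s1 : HasCompactSupport (fun p => fderiv ℝ B1 p (0, 1)) := B1s.fderiv_apply ℝ _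
  have s2 : HasCompactSupport (fun p => fderiv ℝ B2 p (1, 0)) := B2s.fderiv_apply ℝ _
  have e1 := TS_pair g1 m1 i1 _ c1 s1
  have e2 := TT_pair g2 m2 i2 _ c2 s2
  simp only [ftc1 B2c B2s, ftc2 B1c B1s, mul_neg, integral_neg, neg_neg] at e1 e2
  -- replace TS by TT
  have e1' : ∫ p, fderiv ℝ B1 p (0, 1) * TT g2 p = ∫ p, g1 p * B1 p := by
    rw [← e1]
    apply integral_congr_ae
    filter_upwards [hTS] with p hp
    rw [hp]
  have J1 : Integrable (fun p => fderiv ℝ B1 p (0, 1) * TT g2 p) := by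
    simpa using (TT_locInt g2 m2 i2).integrable_smul_left_of_hasCompactSupport c1 s1
  have J2 : Integrable (fun p => fderiv ℝ B2 p (1, 0) * TT g2 p) := by
    simpa using (TT_locInt g2 m2 i2).integrable_smul_left_of_hasCompactSupport c2 s2
  have gB : ∀ g : ℝ × ℝ → ℝ, Integrable g → ∀ F : ℝ × ℝ → ℝ, Continuous F → HasCompactSupport F →
      Integrable (fun p => g p * F p) := by
    intro g hg F hF hFs
    have := hg.locallyIntegrable.integrable_smul_left_of_hasCompactSupport hF hFs
    simpa [mul_comm] using this
  have tot : ∫ p, (fderiv ℝ B2 p (1, 0) - fderiv ℝ B1 p (0, 1)) * TT g2 p =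
      - ∫ p, ((B p).1 * g1 p + (B p).2 * g2 p) := by
    have a : ∫ p, ((B p).1 * g1 p + (B p).2 * g2 p) = ∫ p, (g1 p * B1 p + g2 p * B2 p) := by
      congr 1
      ext p
      by_cases hpΩ : p ∈ Ω
      · have := (hB1 p (subset_closure hpΩ)).self_of_nhds
        have h' := (hB2 p (subset_closure hpΩ)).self_of_nhds
        rw [this, h']; ring
      · rw [h1 p hpΩ, h2 p hpΩ]; ring
    rw [a, integral_add (gB g1 i1 B1 B1c.continuous B1s) (gB g2 i2 B2 B2c.continuous B2s)]
    simp only [sub_mul]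
    rw [integral_sub J2 J1, e1', e2]
    ring
  have tot2 : ∫ p, (fderiv ℝ B2 p (1, 0) - fderiv ℝ B1 p (0, 1)) * TT g2 p =
      ∫ p in Ω, curl2 B p * TT g2 p := by
    rw [← integral_indicator hΩo.measurableSet]
    apply integral_congr_ae
    filter_upwards [hv] with p hp
    by_cases hpΩ : p ∈ Ω
    · rw [indicator_of_mem hpΩ, curl2, (hB1 p (subset_closure hpΩ)).fderiv_eq,
        (hB2 p (subset_closure hpΩ)).fderiv_eq]
    · rw [indicator_of_notMem hpΩ, hp hpΩ, mul_zero]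
  -- L2 bound
  have hcurlc : ContinuousOn (curl2 B) (closure Ω) := by
    have k1 : ContinuousOn (fun p => fderiv ℝ B2 p (1, 0) - fderiv ℝ B1 p (0, 1)) (closure Ω) :=
      (c2.sub c1).continuousOn
    refine k1.congr ?_
    intro p hp
    simp only [curl2]
    rw [(hB1 p hp).fderiv_eq, (hB2 p hp).fderiv_eq]
  have hcurl2 : IntegrableOn (fun p => curl2 B p ^ 2) Ω :=
    ((hcurlc.pow 2).integrableOn_compact hΩb.isCompact_closure).mono_set subset_closure
  have i1' := i1
  have i2' := i2
  rw [Measure.volume_eq_prod] at i1' i2'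
  have G1 : Integrable (fun x => ∫ t, |g1 (x, t)|) := i1'.integral_norm_prod_left
  have G2 : Integrable (fun y => ∫ t, |g2 (t, y)|) := i2'.integral_norm_prod_right
  have GG : Integrable (fun p : ℝ × ℝ => (∫ t, |g1 (p.1, t)|) * ∫ t, |g2 (t, p.2)|) := by
    rw [Measure.volume_eq_prod]
    exact G1.mul_prod G2
  have bT := TT_bound g2 i2
  have bS : ∀ᵐ p : ℝ × ℝ, |TS g1 p| ≤ ∫ t, |g1 (p.1, t)| := by
    have := TT_bound _ (swap_int i1)
    have := swap_mp.quasiMeasurePreserving.ae this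
    filter_upwards [this] with p hp
    simpa [TS] using hp
  have hsq : ∀ᵐ p : ℝ × ℝ, TT g2 p ^ 2 ≤ (∫ t, |g1 (p.1, t)|) * ∫ t, |g2 (t, p.2)| := by
    filter_upwards [bT, bS, hTS] with p q1 q2 q3
    rw [← sq_abs, sq]
    nth_rw 1 [q3]
    exact mul_le_mul q2 q1 (abs_nonneg _) ((abs_nonneg _).trans q2)
  have Hsq : Integrable (fun p => TT g2 p ^ 2) := by
    refine GG.mono' ((TT_meas g2 m2).pow 2).aestronglyMeasurable ?_
    filter_upwards [hsq] with p hp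
    rwa [Real.norm_eq_abs, abs_of_nonneg (sq_nonneg _)]
  have hfin : ∫ p in Ω, TT g2 p ^ 2 ≤ (∫ p, |g1 p|) * ∫ p, |g2 p| := by
    calc ∫ p in Ω, TT g2 p ^ 2 ≤ ∫ p, TT g2 p ^ 2 :=
          setIntegral_le_integral Hsq (Filter.Eventually.of_forall fun _ => sq_nonneg _)
      _ ≤ ∫ p : ℝ × ℝ, (∫ t, |g1 (p.1, t)|) * ∫ t, |g2 (t, p.2)| := integral_mono_ae Hsq GG hsq
      _ = (∫ x, ∫ t, |g1 (x, t)|) * ∫ y, ∫ t, |g2 (t, y)| := by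
          rw [Measure.volume_eq_prod]
          exact integral_prod_mul (fun x => ∫ t, |g1 (x, t)|) (fun y => ∫ t, |g2 (t, y)|)
      _ = (∫ p, |g1 p|) * ∫ p, |g2 p| := by
          rw [Measure.volume_eq_prod, integral_prod _ i1'.abs, integral_prod_symm _ i2'.abs]
  have Hprod : IntegrableOn (fun p => curl2 B p * TT g2 p) Ω := by
    have : IntegrableOn (fun p => (fderiv ℝ B2 p (1, 0) - fderiv ℝ B1 p (0, 1)) * TT g2 p) Ω := by
      simp only [sub_mul]
      exact (J2.sub J1).integrableOn
    refine this.congr_fun ?_ hΩo.measurableSet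
    intro p hpΩ
    simp only [curl2]
    rw [(hB1 p (subset_closure hpΩ)).fderiv_eq, (hB2 p (subset_closure hpΩ)).fderiv_eq]
  have cs := cs_int (μ := volume.restrict Ω) (curl2 B) (TT g2) hcurl2 Hsq.integrableOn Hprod
  have : (∫ p, ((B p).1 * g1 p + (B p).2 * g2 p)) ^ 2 = (∫ p in Ω, curl2 B p * TT g2 p) ^ 2 := by
    rw [← tot2, tot]; ring
  rw [this]
  refine cs.trans ?_
  exact mul_le_mul_of_nonneg_left hfin (integral_nonneg fun _ => sq_nonneg _)

lemma memLp2_of_contOn {F : Type*} [NormedAddCommGroup F] [SecondCountableTopology F]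
    (S : Set (ℝ × ℝ)) (hSo : IsOpen S) (hSb : Bornology.IsBounded S)
    (f : ℝ × ℝ → F) (hf : ContinuousOn f (closure S)) : MemLp f 2 (volume.restrict S) := by
  borelize F
  rw [memLp_two_iff_integrable_sq_norm]
  · exact ((hf.norm.pow 2).integrableOn_compact hSb.isCompact_closure).mono_set subset_closure
  · exact (hf.mono subset_closure).aestronglyMeasurable hSo.measurableSet

lemma L2_norm_sq (μ : Measure (ℝ × ℝ)) (x : Lp ℂ 2 μ) (f : ℝ × ℝ → ℂ) (h : x =ᵐ[μ] f) :
    ‖x‖ ^ 2 = ∫ p, ‖f p‖ ^ 2 ∂μ := by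
  rw [← real_inner_self_eq_norm_sq, L2.inner_def]
  apply integral_congr_ae
  filter_upwards [h] with p hp
  rw [real_inner_self_eq_norm_sq, hp]

/-- weighted gradient fields -/
noncomputable def gradSub (S : Set (ℝ × ℝ)) (w : ℝ × ℝ → ℝ) :
    Submodule ℝ (Lp ℂ 2 (volume.restrict S)) where
  carrier := {x | ∃ φ : ℝ × ℝ → ℝ, ContDiff ℝ 1 φ ∧
    x =ᵐ[volume.restrict S] fun p => ((w p * fderiv ℝ φ p (1, 0) : ℝ) : ℂ) +
      ((w p * fderiv ℝ φ p (0, 1) : ℝ) : ℂ) * Complex.I}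
  zero_mem' := by
    refine ⟨fun _ => 0, contDiff_const, ?_⟩
    filter_upwards [Lp.coeFn_zero ℂ 2 (volume.restrict S)] with p hp
    rw [hp]; simp
  add_mem' := by
    rintro x y ⟨φ, hφ, hx⟩ ⟨χ, hχ, hy⟩
    refine ⟨fun p => φ p + χ p, hφ.add hχ, ?_⟩
    filter_upwards [Lp.coeFn_add x y, hx, hy] with p h1 h2 h3
    rw [h1, Pi.add_apply, h2, h3, fderiv_fun_add (hφ.differentiable one_ne_zero p)
      (hχ.differentiable one_ne_zero p)]
    simp
    ring
  smul_mem' := by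
    rintro c x ⟨φ, hφ, hx⟩
    refine ⟨fun p => c * φ p, contDiff_const.mul hφ, ?_⟩
    filter_upwards [Lp.coeFn_smul c x, hx] with p h1 h2
    rw [h1, Pi.smul_apply, h2, fderiv_const_mul (hφ.differentiable one_ne_zero p)]
    simp
    ring

lemma gauge_lemma (Ω : Set (ℝ × ℝ)) (hΩo : IsOpen Ω) (hΩb : Bornology.IsBounded Ω)
    (hΩn : Ω.Nonempty)
    (L : ℝ) (hL : 0 < L) (M : ℝ → ℝ × ℝ) (hc : ContDiff ℝ 1 M)
    (hp : Function.Periodic M (2 * L))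
    (hd : ∀ s : ℝ, (deriv M s).1 ^ 2 + (deriv M s).2 ^ 2 = 1)
    (hi : Set.InjOn M (Set.Ico 0 (2 * L))) (hr : range M = frontier Ω)
    (S : Set (ℝ × ℝ)) (hSo : IsOpen S) (hSΩ : S ⊆ Ω) (w : ℝ × ℝ → ℝ)
    (hw : ContinuousOn w (closure S))
    (U : Set (ℝ × ℝ)) (hU : IsOpen U) (hΩU : closure Ω ⊆ U) (B : ℝ × ℝ → ℝ × ℝ)
    (hB : ContDiffOn ℝ 1 B U) (η : ℝ) (hη : 0 < η) :
    ∃ φ : ℝ × ℝ → ℝ, ContDiff ℝ 1 φ ∧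
      ∫ p in S, (((B p).1 - fderiv ℝ φ p (1, 0)) ^ 2 + ((B p).2 - fderiv ℝ φ p (0, 1)) ^ 2) * w p ^ 2
        ≤ (∫ p in Ω, curl2 B p ^ 2) * (∫ p in S, w p ^ 2) + η := by
  have hSb : Bornology.IsBounded S := hΩb.subset hSΩ
  set μ := volume.restrict S with hμ
  have hBc : ContinuousOn B (closure S) := hB.continuousOn.mono ((closure_mono hSΩ).trans hΩU)
  have hvec : ∀ v1 v2 : ℝ × ℝ → ℝ, ContinuousOn v1 (closure S) → ContinuousOn v2 (closure S) →
      MemLp (fun p => ((w p * v1 p : ℝ) : ℂ) + ((w p * v2 p : ℝ) : ℂ) * Complex.I) 2 μ := by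
    intro v1 v2 h1 h2
    apply memLp2_of_contOn S hSo hSb
    have a1 := Complex.continuous_ofReal.comp_continuousOn (hw.mul h1)
    have a2 := Complex.continuous_ofReal.comp_continuousOn (hw.mul h2)
    exact a1.add (a2.mul continuousOn_const)
  have hBm := hvec (fun p => (B p).1) (fun p => (B p).2) hBc.fst hBc.snd
  set b : Lp ℂ 2 μ := hBm.toLp _ with hb
  have hbae := hBm.coeFn_toLp
  rw [← hb] at hbae
  set K := (gradSub S w).topologicalClosure with hK
  have hKcl : IsClosed (K : Set (Lp ℂ 2 μ)) := (gradSub S w).isClosed_topologicalClosure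
  have : CompleteSpace K := hKcl.completeSpace_coe
  obtain ⟨y, hy, z, hz, hbyz⟩ := K.exists_add_mem_mem_orthogonal b
  have hzK : ∀ k ∈ K, inner ℝ z k = 0 := fun k hk => (Submodule.mem_orthogonal' K z).1 hz k hk
  -- the divergence-free field
  set w0 : ℝ × ℝ → ℝ := S.indicator w with hw0
  have hw0m : Measurable w0 := by
    classical
    have : w0 = S.piecewise w (fun _ => 0) := by
      ext p; by_cases h : p ∈ S <;> simp [hw0, h]
    rw [this]
    exact ContinuousOn.measurable_piecewise (hw.mono subset_closure) continuousOn_const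
      hSo.measurableSet
  have hzm : Measurable (z : ℝ × ℝ → ℂ) := (Lp.stronglyMeasurable z).measurable
  set g1 : ℝ × ℝ → ℝ := fun p => w0 p * ((z : ℝ × ℝ → ℂ) p).re with hg1
  set g2 : ℝ × ℝ → ℝ := fun p => w0 p * ((z : ℝ × ℝ → ℂ) p).im with hg2
  have m1 : Measurable g1 := hw0m.mul (Complex.measurable_re.comp hzm)
  have m2 : Measurable g2 := hw0m.mul (Complex.measurable_im.comp hzm)
  have hout : ∀ p, p ∉ S → w0 p = 0 := fun p h => indicator_of_notMem h w
  have hin : ∀ p, p ∈ S → w0 p = w p := fun p h => indicator_of_mem h w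
  have hwL2 : MemLp w 2 μ := memLp2_of_contOn S hSo hSb w hw
  have hw0L2 : MemLp w0 2 μ := by
    refine hwL2.ae_eq ?_
    filter_upwards [ae_restrict_mem hSo.measurableSet] with p hp
    exact (hin p hp).symm
  have hzL2 : MemLp (z : ℝ × ℝ → ℂ) 2 μ := Lp.memLp z
  have iS : ∀ f : ℝ × ℝ → ℝ, (∀ p, p ∉ S → f p = 0) → Integrable f μ → Integrable f := by
    intro f h0 hf
    rw [← integrableOn_iff_integrable_of_support_subset (s := S)]
    · exact hf
    · intro p hp
      by_contra h
      exact hp (h0 p h)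
  have i1 : Integrable g1 := iS _ (fun p h => by simp [hg1, hout p h]) (hw0L2.integrable_mul hzL2.re)
  have i2 : Integrable g2 := iS _ (fun p h => by simp [hg2, hout p h]) (hw0L2.integrable_mul hzL2.im)
  have hinner : ∀ (x : Lp ℂ 2 μ) (v1 v2 : ℝ × ℝ → ℝ),
      x =ᵐ[μ] (fun p => ((w p * v1 p : ℝ) : ℂ) + ((w p * v2 p : ℝ) : ℂ) * Complex.I) →
      inner ℝ z x = ∫ p, (g1 p * v1 p + g2 p * v2 p) := by
    intro x v1 v2 hx
    rw [L2.inner_def, ← setIntegral_eq_integral_of_forall_compl_eq_zero (s := S)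
      (f := fun p => g1 p * v1 p + g2 p * v2 p)]
    · apply integral_congr_ae
      filter_upwards [hx, ae_restrict_mem hSo.measurableSet] with p hp hpS
      rw [hp, Complex.inner]
      simp [hg1, hg2, hin p hpS]
      ring
    · intro p hp
      simp [hg1, hg2, hout p hp]
  have hdiv : ∀ φ : ℝ × ℝ → ℝ, ContDiff ℝ 1 φ →
      ∫ p, (g1 p * fderiv ℝ φ p (1, 0) + g2 p * fderiv ℝ φ p (0, 1)) = 0 := by
    intro φ hφ
    have hcf := hφ.continuous_fderiv one_ne_zero
    have hm := hvec (fun p => fderiv ℝ φ p (1, 0)) (fun p => fderiv ℝ φ p (0, 1))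
      (Continuous.continuousOn (by fun_prop)) (Continuous.continuousOn (by fun_prop))
    rw [← hinner (hm.toLp _) _ _ hm.coeFn_toLp]
    apply hzK
    apply Submodule.le_topologicalClosure
    exact ⟨φ, hφ, hm.coeFn_toLp⟩
  have hcore := core Ω hΩo hΩb hΩn L hL M hc hp hd hi hr g1 g2 m1 m2 i1 i2
    (fun q hq => by simp [hg1, hout q (fun h => hq (hSΩ h))])
    (fun q hq => by simp [hg2, hout q (fun h => hq (hSΩ h))]) hdiv U hU hΩU B hB
  have hzb : inner ℝ z b = ‖z‖ ^ 2 := by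
    rw [hbyz, inner_add_right, hzK y hy, zero_add, real_inner_self_eq_norm_sq]
  have hzb' : ∫ p, ((B p).1 * g1 p + (B p).2 * g2 p) = ‖z‖ ^ 2 := by
    rw [← hzb, hinner b _ _ hbae]
    congr 1; ext p; ring
  rw [hzb'] at hcore
  set F := ∫ p in Ω, curl2 B p ^ 2 with hF
  set N := ∫ p in S, w p ^ 2 with hN
  have hF0 : 0 ≤ F := integral_nonneg fun _ => sq_nonneg _
  have hN0 : 0 ≤ N := integral_nonneg fun _ => sq_nonneg _
  set J := ∫ p in S, |w p| * ‖(z : ℝ × ℝ → ℂ) p‖ with hJ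
  have hJi : Integrable (fun p => |w p| * ‖(z : ℝ × ℝ → ℂ) p‖) μ :=
    (hwL2.norm).integrable_mul hzL2.norm
  have hJ0 : 0 ≤ J := integral_nonneg fun _ => by positivity
  have hJ2 : J ^ 2 ≤ N * ‖z‖ ^ 2 := by
    have := cs_int (μ := μ) (fun p => |w p|) (fun p => ‖(z : ℝ × ℝ → ℂ) p‖)
      (by simpa using hwL2.integrable_sq) (hzL2.integrable_norm_pow (by norm_num)) hJi
    rw [L2_norm_sq μ z _ (Filter.EventuallyEq.refl _ _)]
    simpa only [sq_abs] using this
  have hg1J : ∫ p, |g1 p| ≤ J := by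
    rw [← setIntegral_eq_integral_of_forall_compl_eq_zero (s := S)
      (fun p hp => by simp [hg1, hout p hp])]
    apply integral_mono_ae i1.abs.integrableOn hJi
    filter_upwards [ae_restrict_mem hSo.measurableSet] with p hp
    simp only [hg1, hin p hp, abs_mul]
    exact mul_le_mul_of_nonneg_left (Complex.abs_re_le_norm _) (abs_nonneg _)
  have hg2J : ∫ p, |g2 p| ≤ J := by
    rw [← setIntegral_eq_integral_of_forall_compl_eq_zero (s := S)
      (fun p hp => by simp [hg2, hout p hp])]
    apply integral_mono_ae i2.abs.integrableOn hJi
    filter_upwards [ae_restrict_mem hSo.measurableSet] with p hp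
    simp only [hg2, hin p hp, abs_mul]
    exact mul_le_mul_of_nonneg_left (Complex.abs_im_le_norm _) (abs_nonneg _)
  have hzz : ‖z‖ ^ 2 ≤ F * N := by
    have h1 : (∫ p, |g1 p|) * ∫ p, |g2 p| ≤ J * J :=
      mul_le_mul hg1J hg2J (integral_nonneg fun _ => abs_nonneg _) hJ0
    have h2 : (‖z‖ ^ 2) ^ 2 ≤ F * (N * ‖z‖ ^ 2) := by
      refine hcore.trans (mul_le_mul_of_nonneg_left (h1.trans ?_) hF0)
      rw [← sq]; exact hJ2
    rcases eq_or_lt_of_le (sq_nonneg ‖z‖) with h | h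
    · rw [← h]; positivity
    · have : ‖z‖ ^ 2 * ‖z‖ ^ 2 ≤ (F * N) * ‖z‖ ^ 2 := by nlinarith
      exact le_of_mul_le_mul_right this h
  -- approximation
  have hycl : y ∈ closure (gradSub S w : Set (Lp ℂ 2 μ)) := by
    rw [← Submodule.topologicalClosure_coe]; exact hy
  obtain ⟨k, hk, hyk⟩ := Metric.mem_closure_iff.1 hycl (Real.sqrt η) (Real.sqrt_pos.2 hη)
  have hkK : k ∈ K := Submodule.le_topologicalClosure _ hk
  obtain ⟨φ, hφ, hkφ⟩ := hk
  refine ⟨φ, hφ, ?_⟩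
  have hyk2 : ‖y - k‖ ^ 2 ≤ η := by
    rw [dist_eq_norm] at hyk
    have := Real.sq_sqrt hη.le
    have h0 := norm_nonneg (y - k)
    nlinarith
  have hbk : ‖b - k‖ ^ 2 = ‖z‖ ^ 2 + ‖y - k‖ ^ 2 := by
    have : b - k = z + (y - k) := by rw [hbyz]; abel
    rw [this, norm_add_sq_real, hzK (y - k) (K.sub_mem hy hkK)]
    ring
  have hbk2 : ‖b - k‖ ^ 2 = ∫ p in S, (((B p).1 - fderiv ℝ φ p (1, 0)) ^ 2 +
      ((B p).2 - fderiv ℝ φ p (0, 1)) ^ 2) * w p ^ 2 := by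
    rw [L2_norm_sq μ (b - k) _ (Filter.EventuallyEq.refl _ _)]
    apply integral_congr_ae
    filter_upwards [Lp.coeFn_sub b k, hbae, hkφ] with p h1 h2 h3
    rw [h1, Pi.sub_apply, h2, h3, ← Complex.normSq_eq_norm_sq, Complex.normSq_apply]
    simp
    ring
  rw [← hbk2, hbk]
  linarith

lemma omegaEps_open (Ω : Set (ℝ × ℝ)) (hΩo : IsOpen Ω) (ε : ℝ) : IsOpen (OmegaEps Ω ε) :=
  hΩo.inter (isOpen_lt (Metric.continuous_infDist_pt _) continuous_const)

lemma omegaEps_sub (Ω : Set (ℝ × ℝ)) (ε : ℝ) : OmegaEps Ω ε ⊆ Ω := fun _ h => h.1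

lemma omegaEps_nonempty (Ω : Set (ℝ × ℝ)) (hf : (frontier Ω).Nonempty) (ε : ℝ) (hε : 0 < ε) :
    (OmegaEps Ω ε).Nonempty := by
  obtain ⟨p, hp⟩ := hf
  obtain ⟨q, hq, hpq⟩ := Metric.mem_closure_iff.1 (frontier_subset_closure hp) ε hε
  refine ⟨q, hq, ?_⟩
  refine (Metric.infDist_le_dist_of_mem hp).trans_lt ?_
  rwa [dist_comm]

lemma vol_small (Ω : Set (ℝ × ℝ)) (hΩo : IsOpen Ω) (hΩb : Bornology.IsBounded Ω)
    (hf : (frontier Ω).Nonempty) :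
    ∃ ε₀ > 0, ∀ ε ∈ Set.Ioc (0 : ℝ) ε₀, volume.real (OmegaEps Ω ε) ≤ 1 / 4 := by
  have hmono : ∀ a b : ℝ, a ≤ b → OmegaEps Ω a ⊆ OmegaEps Ω b :=
    fun a b h x hx => ⟨hx.1, hx.2.trans_le h⟩
  have hfin : ∀ ε, volume (OmegaEps Ω ε) ≠ ⊤ := fun ε =>
    ((measure_mono (omegaEps_sub Ω ε)).trans_lt hΩb.measure_lt_top).ne
  have hlim := tendsto_measure_iInter_atTop (μ := (volume : Measure (ℝ × ℝ)))
    (s := fun n : ℕ => OmegaEps Ω (1 / ((n : ℝ) + 1)))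
    (fun n => (omegaEps_open Ω hΩo _).measurableSet.nullMeasurableSet)
    (fun m n hmn => hmono _ _ (by
      apply one_div_le_one_div_of_le (by positivity)
      have : (m : ℝ) ≤ n := by exact_mod_cast hmn
      linarith)) ⟨0, hfin _⟩
  have hempty : ⋂ n : ℕ, OmegaEps Ω (1 / ((n : ℝ) + 1)) = ∅ := by
    ext x
    simp only [mem_iInter, mem_empty_iff_false, iff_false]
    intro h
    have hx := (h 0).1
    have hnot : x ∉ frontier Ω := by
      rw [hΩo.frontier_eq]; exact fun h => h.2 hx
    have hpos := (isClosed_frontier.notMem_iff_infDist_pos hf).1 hnot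
    obtain ⟨n, hn⟩ := exists_nat_one_div_lt hpos
    exact absurd (h n).2 (not_lt.2 hn.le)
  rw [hempty, measure_empty] at hlim
  have hev := hlim.eventually (gt_mem_nhds (show (0 : ENNReal) < ENNReal.ofReal (1 / 4) by
    simp))
  obtain ⟨n, hn⟩ := hev.exists
  refine ⟨1 / ((n : ℝ) + 1), by positivity, fun ε hε => ?_⟩
  have := (measure_mono (μ := volume) (hmono _ _ hε.2)).trans hn.le
  rw [measureReal_def]
  exact ENNReal.toReal_le_of_le_ofReal (by norm_num) this

lemma int_of_contOn (S : Set (ℝ × ℝ)) (hSb : Bornology.IsBounded S)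
    (f : ℝ × ℝ → ℝ) (hf : ContinuousOn f (closure S)) : IntegrableOn f S :=
  (hf.integrableOn_compact hSb.isCompact_closure).mono_set subset_closure

lemma C1Nhd.contOn {E : Type*} [NormedAddCommGroup E] [NormedSpace ℝ E]
    {f : ℝ × ℝ → E} {S : Set (ℝ × ℝ)} (h : C1Nhd f S) : ContinuousOn f (closure S) := by
  obtain ⟨U, hU, hSU, hf⟩ := h
  exact hf.continuousOn.mono hSU

lemma C1Nhd.mono {E : Type*} [NormedAddCommGroup E] [NormedSpace ℝ E]
    {f : ℝ × ℝ → E} {S T : Set (ℝ × ℝ)} (h : C1Nhd f S) (hT : T ⊆ S) : C1Nhd f T := by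
  obtain ⟨U, hU, hSU, hf⟩ := h
  exact ⟨U, hU, (closure_mono hT).trans hSU, hf⟩

lemma C1Nhd.contOn_fderiv {E : Type*} [NormedAddCommGroup E] [NormedSpace ℝ E]
    {f : ℝ × ℝ → E} {S : Set (ℝ × ℝ)} (h : C1Nhd f S) :
    ContinuousOn (fderiv ℝ f) (closure S) := by
  obtain ⟨U, hU, hSU, hf⟩ := h
  exact (hf.continuousOn_fderiv_of_isOpen hU le_rfl).mono hSU

lemma C1Nhd.diffAt {E : Type*} [NormedAddCommGroup E] [NormedSpace ℝ E]
    {f : ℝ × ℝ → E} {S : Set (ℝ × ℝ)} (h : C1Nhd f S) {x : ℝ × ℝ} (hx : x ∈ S) :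
    DifferentiableAt ℝ f x := by
  obtain ⟨U, hU, hSU, hf⟩ := h
  exact (hf.contDiffAt (hU.mem_nhds (hSU (subset_closure hx)))).differentiableAt one_ne_zero

lemma mg_contOn {S : Set (ℝ × ℝ)} (b : ℝ) (A : ℝ × ℝ → ℝ × ℝ) (u : ℝ × ℝ → ℂ)
    (hA : C1Nhd A S) (hu : C1Nhd u S) : ContinuousOn (mgNormSq b A u) (closure S) := by
  have h1 := hA.contOn
  have h2 := hu.contOn
  have h3 := hu.contOn_fderiv
  have a1 := Complex.continuous_ofReal.comp_continuousOn h1.fst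
  have a2 := Complex.continuous_ofReal.comp_continuousOn h1.snd
  have d1 : ContinuousOn (fun x => fderiv ℝ u x (1, 0)) (closure S) := h3.clm_apply continuousOn_const
  have d2 : ContinuousOn (fun x => fderiv ℝ u x (0, 1)) (closure S) := h3.clm_apply continuousOn_const
  exact ((d1.sub ((continuousOn_const.mul a1).mul h2)).norm.pow 2).add
    ((d2.sub ((continuousOn_const.mul a2).mul h2)).norm.pow 2)

lemma mg_nonneg (b : ℝ) (A : ℝ × ℝ → ℝ × ℝ) (u : ℝ × ℝ → ℂ) (x : ℝ × ℝ) :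
    0 ≤ mgNormSq b A u x := by unfold mgNormSq; positivity

lemma norm_young (p q : ℂ) (δ : ℝ) (hδ : 0 < δ) :
    ‖p + q‖ ^ 2 ≤ (1 + δ) * ‖p‖ ^ 2 + (1 + 1 / δ) * ‖q‖ ^ 2 := by
  have h := norm_add_le p q
  have h0 := norm_nonneg (p + q)
  have h1 : ‖p + q‖ ^ 2 ≤ (‖p‖ + ‖q‖) ^ 2 := by gcongr
  have h2 : 2 * ‖p‖ * ‖q‖ ≤ δ * ‖p‖ ^ 2 + 1 / δ * ‖q‖ ^ 2 := by
    have : 0 ≤ (δ * ‖p‖ - ‖q‖) ^ 2 / δ := by positivity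
    have e : (δ * ‖p‖ - ‖q‖) ^ 2 / δ = δ * ‖p‖ ^ 2 + 1 / δ * ‖q‖ ^ 2 - 2 * ‖p‖ * ‖q‖ := by
      field_simp; ring
    linarith
  nlinarith

lemma mg_gauge (H δ : ℝ) (hδ : 0 < δ) (A A' : ℝ × ℝ → ℝ × ℝ) (ψ : ℝ × ℝ → ℂ) (φ : ℝ × ℝ → ℝ)
    (x : ℝ × ℝ) (hψ : DifferentiableAt ℝ ψ x) (hφ : DifferentiableAt ℝ φ x) :
    mgNormSq H A (fun y => ψ y * Complex.exp (-(Complex.I * (H : ℂ) * (φ y : ℂ)))) x ≤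
      (1 + δ) * mgNormSq H A' ψ x + (1 + 1 / δ) * H ^ 2 *
        (((((A' x).1 - (A x).1) - fderiv ℝ φ x (1, 0)) ^ 2 +
          (((A' x).2 - (A x).2) - fderiv ℝ φ x (0, 1)) ^ 2) * ‖ψ x‖ ^ 2) := by
  have hφc : HasFDerivAt (fun y => (φ y : ℂ)) (Complex.ofRealCLM.comp (fderiv ℝ φ x)) x :=
    Complex.ofRealCLM.hasFDerivAt.comp x hφ.hasFDerivAt
  have he := ((hφc.const_mul (Complex.I * (H : ℂ))).neg).cexp
  have hu := hψ.hasFDerivAt.mul he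
  have hn : ‖Complex.exp (-(Complex.I * (H : ℂ) * (φ x : ℂ)))‖ = 1 := by
    rw [Complex.norm_exp]; simp
  have key : ∀ (v : ℝ × ℝ) (a a' : ℝ),
      ‖fderiv ℝ (fun y => ψ y * Complex.exp (-(Complex.I * (H : ℂ) * (φ y : ℂ)))) x v
        - Complex.I * (H : ℂ) * (a : ℂ) * (ψ x * Complex.exp (-(Complex.I * (H : ℂ) * (φ x : ℂ))))‖ ^ 2
      ≤ (1 + δ) * ‖fderiv ℝ ψ x v - Complex.I * (H : ℂ) * (a' : ℂ) * ψ x‖ ^ 2 +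
        (1 + 1 / δ) * H ^ 2 * (((a' - a) - fderiv ℝ φ x v) ^ 2 * ‖ψ x‖ ^ 2) := by
    intro v a a'
    have e : fderiv ℝ (fun y => ψ y * Complex.exp (-(Complex.I * (H : ℂ) * (φ y : ℂ)))) x v
        - Complex.I * (H : ℂ) * (a : ℂ) * (ψ x * Complex.exp (-(Complex.I * (H : ℂ) * (φ x : ℂ))))
        = Complex.exp (-(Complex.I * (H : ℂ) * (φ x : ℂ))) *
          ((fderiv ℝ ψ x v - Complex.I * (H : ℂ) * (a' : ℂ) * ψ x) +
            Complex.I * (H : ℂ) * (((a' - a) - fderiv ℝ φ x v : ℝ) : ℂ) * ψ x) := by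
      rw [show fderiv ℝ (fun y => ψ y * Complex.exp (-(Complex.I * (H : ℂ) * (φ y : ℂ)))) x = _
        from hu.fderiv]
      simp
      ring
    rw [e, norm_mul, hn, one_mul]
    refine (norm_young _ _ δ hδ).trans (le_of_eq ?_)
    congr 1
    rw [norm_mul, norm_mul, norm_mul, Complex.norm_I, Complex.norm_real, Complex.norm_real]
    simp only [Real.norm_eq_abs, mul_pow, sq_abs]
    ring
  have k1 := key (1, 0) (A x).1 (A' x).1
  have k2 := key (0, 1) (A x).2 (A' x).2
  unfold mgNormSq
  linarith

lemma int_three (S : Set (ℝ × ℝ)) (f g h : ℝ × ℝ → ℝ) (a b c : ℝ) (hf : IntegrableOn f S)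
    (hg : IntegrableOn g S) (hh : IntegrableOn h S) :
    ∫ x in S, (a * f x - b * g x + c * h x) =
      a * (∫ x in S, f x) - b * (∫ x in S, g x) + c * (∫ x in S, h x) := by
  have e1 := integral_add (μ := volume.restrict S) ((hf.const_mul a).sub (hg.const_mul b))
    (hh.const_mul c)
  have e2 := integral_sub (μ := volume.restrict S) (hf.const_mul a) (hg.const_mul b)
  simp only [Pi.sub_apply] at e1
  rw [e1, e2, integral_const_mul, integral_const_mul, integral_const_mul]

lemma gl_num (κ H X N P F V η : ℝ) (hN : 0 < N) (hF : 0 ≤ F)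
    (hV : 0 < V) (hV4 : V ≤ 1 / 4) (hNP : N ^ 2 ≤ V * P) (hN2 : N < 2 * V)
    (hE : X - κ ^ 2 * N + κ ^ 2 / 2 * P + H ^ 2 * F < 0)
    (hη : (1 + 1 / (N / (2 * V))) * H ^ 2 * η < -(X - κ ^ 2 * N + κ ^ 2 / 2 * P + H ^ 2 * F)) :
    (1 + N / (2 * V)) * X + (1 + 1 / (N / (2 * V))) * H ^ 2 * (F * N + η) < κ ^ 2 * N := by
  have hP : 0 ≤ P := by
    by_contra h
    push Not at h
    nlinarith [sq_nonneg N]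
  have h1 : X ≤ κ ^ 2 * N := by
    have : 0 ≤ κ ^ 2 / 2 * P := by positivity
    have : 0 ≤ H ^ 2 * F := by positivity
    linarith
  have h2 : N / (2 * V) * X ≤ κ ^ 2 / 2 * P := by
    calc N / (2 * V) * X ≤ N / (2 * V) * (κ ^ 2 * N) := by gcongr
      _ = κ ^ 2 / 2 * (N ^ 2 / V) := by field_simp
      _ ≤ κ ^ 2 / 2 * P := by
        gcongr
        rw [div_le_iff₀ hV]; linarith
  have h3 : (1 + 1 / (N / (2 * V))) * H ^ 2 * (F * N) ≤ H ^ 2 * F := by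
    have e : (1 + 1 / (N / (2 * V))) * H ^ 2 * (F * N) = (N + 2 * V) * (H ^ 2 * F) := by
      field_simp
    rw [e]
    have : 0 ≤ H ^ 2 * F := by positivity
    nlinarith
  linarith

lemma lam_lt (Ω : Set (ℝ × ℝ)) (hΩo : IsOpen Ω) (hΩb : Bornology.IsBounded Ω)
    (hΩn : Ω.Nonempty) (L : ℝ) (hL : 0 < L) (M : ℝ → ℝ × ℝ) (hM : BoundaryParam Ω L M)
    (A : ℝ × ℝ → ℝ × ℝ) (hA : C1Nhd A Ω) (hcurl : ∀ x ∈ Ω, curl2 A x = 1)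
    (κ : ℝ) (ε : ℝ) (hV : 0 < volume.real (OmegaEps Ω ε))
    (hV4 : volume.real (OmegaEps Ω ε) ≤ 1 / 4) (H : ℝ) (ψ : ℝ × ℝ → ℂ) (A' : ℝ × ℝ → ℝ × ℝ)
    (hadm : GLadm Ω ε ψ A') (hE : GLenergy Ω κ H ε ψ A' < 0) : lam Ω A ε H < κ ^ 2 := by
  obtain ⟨hψ, hA'⟩ := hadm
  unfold GLenergy at hE
  set S := OmegaEps Ω ε with hS
  have hSo : IsOpen S := omegaEps_open Ω hΩo ε
  have hSΩ : S ⊆ Ω := omegaEps_sub Ω ε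
  have hSb : Bornology.IsBounded S := hΩb.subset hSΩ
  have hSfin : volume S ≠ ⊤ := hSb.measure_lt_top.ne
  have iX : IntegrableOn (mgNormSq H A' ψ) S :=
    int_of_contOn S hSb _ (mg_contOn H A' ψ (hA'.mono hSΩ) hψ)
  have iN : IntegrableOn (fun x => ‖ψ x‖ ^ 2) S := int_of_contOn S hSb _ (hψ.contOn.norm.pow 2)
  have iP : IntegrableOn (fun x => ‖ψ x‖ ^ 4) S := int_of_contOn S hSb _ (hψ.contOn.norm.pow 4)
  have h3 := int_three S _ _ _ 1 (κ ^ 2) (κ ^ 2 / 2) iX iN iP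
  simp only [one_mul] at h3
  rw [h3] at hE
  set X := ∫ x in S, mgNormSq H A' ψ x with hXd
  set N := ∫ x in S, ‖ψ x‖ ^ 2 with hNd
  set P := ∫ x in S, ‖ψ x‖ ^ 4 with hPd
  set F := ∫ x in Ω, (curl2 A' x - 1) ^ 2 with hFd
  set V := volume.real S with hVd
  have hX0 : 0 ≤ X := integral_nonneg fun x => mg_nonneg _ _ _ _
  have hN0 : 0 ≤ N := integral_nonneg fun x => by positivity
  have hP0 : 0 ≤ P := integral_nonneg fun x => by positivity
  have hF0 : 0 ≤ F := integral_nonneg fun x => sq_nonneg _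
  have hNP : N ^ 2 ≤ V * P := by
    have := cs_int (μ := volume.restrict S) (fun _ => 1) (fun x => ‖ψ x‖ ^ 2)
      (by simpa [IntegrableOn] using integrableOn_const (C := (1 : ℝ)) hSfin)
      (by simpa [IntegrableOn, ← pow_mul] using iP) (by simpa [IntegrableOn] using iN)
    simpa [← pow_mul, ← hVd, ← hPd, ← hNd] using this
  have hPN : κ ^ 2 * P < κ ^ 2 * (2 * N) := by
    have : 0 ≤ H ^ 2 * F := by positivity
    nlinarith
  have hκ2 : 0 < κ ^ 2 := by
    rcases (sq_nonneg κ).eq_or_lt with h | h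
    · rw [← h] at hPN; simp at hPN
    · exact h
  have hPN' : P < 2 * N := lt_of_mul_lt_mul_left hPN hκ2.le
  have hNpos : 0 < N := by linarith
  have hN2 : N < 2 * V := by
    have : N * N < N * (2 * V) := by nlinarith
    exact lt_of_mul_lt_mul_left this hN0
  set δ := N / (2 * V) with hδ
  have hδ0 : 0 < δ := by positivity
  set c := (1 + 1 / δ) * H ^ 2 with hc
  have hc0 : 0 ≤ c := by positivity
  set g := -(X - κ ^ 2 * N + κ ^ 2 / 2 * P + H ^ 2 * F) with hg
  have hg0 : 0 < g := by linarith
  set η := g / (c + 1) with hη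
  have hη0 : 0 < η := by positivity
  have hcη : c * η < g := by
    have e : c * η + η = g := by rw [hη]; field_simp
    linarith
  obtain ⟨U1, hU1, hΩU1, hAU⟩ := id hA
  obtain ⟨U2, hU2, hΩU2, hAU'⟩ := id hA'
  obtain ⟨m1, m2, m3, m4, m5⟩ := hM
  obtain ⟨φ, hφ, hφB⟩ := gauge_lemma Ω hΩo hΩb hΩn L hL M (m1.of_le (by norm_num)) m2 m3 m4 m5
    S hSo hSΩ (fun x => ‖ψ x‖) hψ.contOn.norm (U1 ∩ U2) (hU1.inter hU2)
    (subset_inter hΩU1 hΩU2) (fun x => A' x - A x)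
    ((hAU'.mono inter_subset_right).sub (hAU.mono inter_subset_left)) η hη0
  have hFB : ∫ p in Ω, curl2 (fun x => A' x - A x) p ^ 2 = F := by
    apply setIntegral_congr_fun hΩo.measurableSet
    intro x hx
    have d1 := hA.diffAt hx
    have d2 := hA'.diffAt hx
    have e : curl2 (fun x => A' x - A x) x = curl2 A' x - curl2 A x := by
      unfold curl2
      simp only [Prod.fst_sub, Prod.snd_sub]
      rw [fderiv_fun_sub d2.snd d1.snd, fderiv_fun_sub d2.fst d1.fst]
      simp only [sub_apply]
      ring
    simp only [e, hcurl x hx]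
  rw [hFB] at hφB
  have hu : C1Nhd (fun y => ψ y * Complex.exp (-(Complex.I * (H : ℂ) * (φ y : ℂ)))) S := by
    obtain ⟨U, hU, hSU, hψU⟩ := hψ
    refine ⟨U, hU, hSU, hψU.mul (ContDiff.contDiffOn ?_)⟩
    exact ((contDiff_const.mul (Complex.ofRealCLM.contDiff.comp hφ)).neg).cexp
  have hun : ∀ x, ‖ψ x * Complex.exp (-(Complex.I * (H : ℂ) * (φ x : ℂ)))‖ = ‖ψ x‖ := by
    intro x
    rw [norm_mul, Complex.norm_exp]; simp
  have iW : IntegrableOn (fun p => (((A' p - A p).1 - fderiv ℝ φ p (1, 0)) ^ 2 +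
      ((A' p - A p).2 - fderiv ℝ φ p (0, 1)) ^ 2) * ‖ψ p‖ ^ 2) S := by
    apply int_of_contOn S hSb
    have hcf := hφ.continuous_fderiv one_ne_zero
    have hB := ((hA'.mono hSΩ).contOn).sub (hA.mono hSΩ).contOn
    have d1 : Continuous fun p => fderiv ℝ φ p (1, 0) := by fun_prop
    have d2 : Continuous fun p => fderiv ℝ φ p (0, 1) := by fun_prop
    exact (((hB.fst.sub d1.continuousOn).pow 2).add ((hB.snd.sub d2.continuousOn).pow 2)).mul
      (hψ.contOn.norm.pow 2)
  have hT : ∫ x in S, mgNormSq H A (fun y => ψ y * Complex.exp (-(Complex.I * (H : ℂ) * (φ y : ℂ)))) x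
      < κ ^ 2 * N := by
    refine lt_of_le_of_lt ?_ (gl_num κ H X N P F V η hNpos hF0 hV hV4 hNP hN2 hE hcη)
    refine (setIntegral_mono_on (int_of_contOn S hSb _ (mg_contOn H A _ (hA.mono hSΩ) hu))
      ((iX.const_mul (1 + δ)).add (iW.const_mul c)) hSo.measurableSet
      (fun x hx => mg_gauge H δ hδ0 A A' ψ φ x (hψ.diffAt hx)
        (hφ.differentiable one_ne_zero x))).trans ?_
    have e := integral_add (μ := volume.restrict S) (iX.const_mul (1 + δ)) (iW.const_mul c)
    rw [integral_const_mul, integral_const_mul] at e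
    refine (le_of_eq e).trans ?_
    gcongr
  refine csInf_lt_of_lt ⟨0, ?_⟩ ⟨_, hu, ?_, rfl⟩ ?_
  · rintro r ⟨u, -, h, rfl⟩
    exact div_nonneg (integral_nonneg fun x => mg_nonneg _ _ _ _) h.le
  · simpa only [hun] using hNpos
  · simp only [hun]
    rw [div_lt_iff₀ hNpos]
    exact hT

lemma egs_bdd (Ω : Set (ℝ × ℝ)) (hΩo : IsOpen Ω) (hΩb : Bornology.IsBounded Ω) (κ H ε : ℝ) :
    BddBelow { E : ℝ | ∃ ψ A', GLadm Ω ε ψ A' ∧ E = GLenergy Ω κ H ε ψ A' } := by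
  refine ⟨∫ _ in OmegaEps Ω ε, -(κ ^ 2 / 2), ?_⟩
  rintro E ⟨ψ, A', ⟨hψ, hA'⟩, rfl⟩
  have hSΩ := omegaEps_sub Ω ε
  have hSb : Bornology.IsBounded (OmegaEps Ω ε) := hΩb.subset hSΩ
  have h1 : ∫ _ in OmegaEps Ω ε, -(κ ^ 2 / 2) ≤ ∫ x in OmegaEps Ω ε,
      (mgNormSq H A' ψ x - κ ^ 2 * ‖ψ x‖ ^ 2 + κ ^ 2 / 2 * ‖ψ x‖ ^ 4) := by
    apply setIntegral_mono_on (integrableOn_const hSb.measure_lt_top.ne) _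
      (omegaEps_open Ω hΩo ε).measurableSet
    · intro x hx
      have := mg_nonneg H A' ψ x
      have h2 : 0 ≤ κ ^ 2 / 2 * (‖ψ x‖ ^ 2 - 1) ^ 2 := by positivity
      nlinarith
    · apply int_of_contOn _ hSb
      exact ((mg_contOn H A' ψ (hA'.mono hSΩ) hψ).sub
        (continuousOn_const.mul (hψ.contOn.norm.pow 2))).add
        (continuousOn_const.mul (hψ.contOn.norm.pow 4))
  have h2 : 0 ≤ H ^ 2 * ∫ x in Ω, (curl2 A' x - 1) ^ 2 :=
    mul_nonneg (sq_nonneg _) (integral_nonneg fun x => sq_nonneg _)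
  unfold GLenergy
  linarith

lemma egs_lt (Ω : Set (ℝ × ℝ)) (hΩo : IsOpen Ω) (hΩb : Bornology.IsBounded Ω)
    (A : ℝ × ℝ → ℝ × ℝ) (hA : C1Nhd A Ω) (hcurl : ∀ x ∈ Ω, curl2 A x = 1)
    (κ : ℝ) (ε : ℝ) (H : ℝ) (u : ℝ × ℝ → ℂ) (hu : C1Nhd u (OmegaEps Ω ε))
    (hQ : ∫ x in OmegaEps Ω ε, mgNormSq H A u x < κ ^ 2 * ∫ x in OmegaEps Ω ε, ‖u x‖ ^ 2) :
    Egs Ω κ H ε < 0 := by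
  have hb := egs_bdd Ω hΩo hΩb κ H ε
  unfold Egs
  have hSΩ : OmegaEps Ω ε ⊆ Ω := omegaEps_sub Ω ε
  have hSb : Bornology.IsBounded (OmegaEps Ω ε) := hΩb.subset hSΩ
  have iX := int_of_contOn _ hSb _ (mg_contOn H A u (hA.mono hSΩ) hu)
  have iN : IntegrableOn (fun x => ‖u x‖ ^ 2) (OmegaEps Ω ε) := int_of_contOn _ hSb _ (hu.contOn.norm.pow 2)
  have iP : IntegrableOn (fun x => ‖u x‖ ^ 4) (OmegaEps Ω ε) := int_of_contOn _ hSb _ (hu.contOn.norm.pow 4)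
  set X := ∫ x in OmegaEps Ω ε, mgNormSq H A u x with hXd
  set N := ∫ x in OmegaEps Ω ε, ‖u x‖ ^ 2 with hNd
  set P := ∫ x in OmegaEps Ω ε, ‖u x‖ ^ 4 with hPd
  have hP0 : 0 ≤ P := integral_nonneg fun x => by positivity
  set g := κ ^ 2 * N - X with hg
  have hg0 : 0 < g := by linarith
  set s := g / (κ ^ 2 / 2 * P + 1) with hs
  have hs0 : 0 < s := by positivity
  set t := Real.sqrt s with ht
  have ht2 : t ^ 2 = s := Real.sq_sqrt hs0.le
  have ht0 : 0 < t := Real.sqrt_pos.2 hs0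
  have htu : C1Nhd (fun x => (t : ℂ) * u x) (OmegaEps Ω ε) := by
    obtain ⟨U, hU, hSU, h⟩ := hu
    exact ⟨U, hU, hSU, contDiffOn_const.mul h⟩
  refine csInf_lt_of_lt hb ⟨fun x => (t : ℂ) * u x, A, ⟨htu, hA⟩, rfl⟩ ?_
  unfold GLenergy
  have hz : ∫ x in Ω, (curl2 A x - 1) ^ 2 = 0 := by
    rw [setIntegral_congr_fun (g := fun _ => (0 : ℝ)) hΩo.measurableSet
      (fun x hx => by simp [hcurl x hx])]
    simp
  have he : ∫ x in OmegaEps Ω ε, (mgNormSq H A (fun x => (t : ℂ) * u x) x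
      - κ ^ 2 * ‖(t : ℂ) * u x‖ ^ 2 + κ ^ 2 / 2 * ‖(t : ℂ) * u x‖ ^ 4) =
      ∫ x in OmegaEps Ω ε, (t ^ 2 * mgNormSq H A u x - (κ ^ 2 * t ^ 2) * ‖u x‖ ^ 2
        + (κ ^ 2 / 2 * t ^ 4) * ‖u x‖ ^ 4) := by
    apply setIntegral_congr_fun (omegaEps_open Ω hΩo ε).measurableSet
    intro x hx
    have hd := hu.diffAt hx
    have hm : mgNormSq H A (fun x => (t : ℂ) * u x) x = t ^ 2 * mgNormSq H A u x := by
      unfold mgNormSq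
      rw [fderiv_const_mul hd]
      have : ∀ (v a : ℂ), ‖(t : ℂ) * v - Complex.I * (H : ℂ) * a * ((t : ℂ) * u x)‖ ^ 2 =
          t ^ 2 * ‖v - Complex.I * (H : ℂ) * a * u x‖ ^ 2 := by
        intro v a
        rw [show (t : ℂ) * v - Complex.I * (H : ℂ) * a * ((t : ℂ) * u x) =
          (t : ℂ) * (v - Complex.I * (H : ℂ) * a * u x) by ring, norm_mul, mul_pow,
          Complex.norm_real, Real.norm_eq_abs, sq_abs]
      simp only [smul_apply, smul_eq_mul, this]
      ring
    simp only [hm, norm_mul, Complex.norm_real, Real.norm_eq_abs, abs_of_pos ht0]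
    ring
  rw [he, hz, int_three _ _ _ _ _ _ _ iX iN iP]
  change t ^ 2 * X - κ ^ 2 * t ^ 2 * N + κ ^ 2 / 2 * t ^ 4 * P + H ^ 2 * 0 < 0
  have e : κ ^ 2 / 2 * P * s + s = g := by rw [hs]; field_simp
  have e4 : t ^ 4 = s ^ 2 := by rw [← ht2]; ring
  rw [e4, ht2]
  have : s * X - κ ^ 2 * s * N + κ ^ 2 / 2 * s ^ 2 * P + H ^ 2 * 0 = - s ^ 2 := by
    have : X = κ ^ 2 * N - g := by rw [hg]; ring
    rw [this, ← e]; ring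
  rw [this]
  have : 0 < s ^ 2 := by positivity
  linarith

/-- For small thickness, the Ginzburg–Landau model admits a non-trivial state
(negative ground-state energy) if and only if `λ(ε, H) < κ²`. -/
theorem stmt_3 (Ω : Set (ℝ × ℝ)) (hΩo : IsOpen Ω) (hΩb : Bornology.IsBounded Ω)
    (hΩsc : SimplyConnectedSpace ↥Ω)
    (L : ℝ) (hL : 0 < L) (M : ℝ → ℝ × ℝ) (hM : BoundaryParam Ω L M)
    (A : ℝ × ℝ → ℝ × ℝ) (hA : C1Nhd A Ω) (hcurl : ∀ x ∈ Ω, curl2 A x = 1)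
    (κ : ℝ) (hκ : 0 < κ) :
    ∃ ε₀ > 0, ∀ ε ∈ Set.Ioc (0 : ℝ) ε₀, ∀ H ≥ (0 : ℝ),
      (Egs Ω κ H ε < 0 ↔ lam Ω A ε H < κ ^ 2) := by
  have hfr : (frontier Ω).Nonempty := by
    rw [← hM.2.2.2.2]; exact range_nonempty M
  have hΩn : Ω.Nonempty := closure_nonempty_iff.1 (hfr.mono frontier_subset_closure)
  obtain ⟨ε₀, hε₀, hvol⟩ := vol_small Ω hΩo hΩb hfr
  refine ⟨ε₀, hε₀, fun ε hε H _ => ?_⟩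
  have hSo := omegaEps_open Ω hΩo ε
  have hSb : Bornology.IsBounded (OmegaEps Ω ε) := hΩb.subset (omegaEps_sub Ω ε)
  have hV : 0 < volume.real (OmegaEps Ω ε) :=
    ENNReal.toReal_pos (hSo.measure_pos volume (omegaEps_nonempty Ω hfr ε hε.1)).ne'
      hSb.measure_lt_top.ne
  constructor
  · intro h
    obtain ⟨E, ⟨ψ, A', hadm, rfl⟩, hE⟩ := exists_lt_of_csInf_lt (s := { E : ℝ | ∃ ψ A', GLadm Ω ε ψ A' ∧ E = GLenergy Ω κ H ε ψ A' })
      ⟨_, fun _ => 0, A, ⟨⟨univ, isOpen_univ, subset_univ _, contDiffOn_const⟩, hA⟩, rfl⟩ h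
    exact lam_lt Ω hΩo hΩb hΩn L hL M hM A hA hcurl κ ε hV (hvol ε hε) H ψ A' hadm hE
  · intro h
    obtain ⟨r, ⟨u, hu, hN, rfl⟩, hr⟩ := exists_lt_of_csInf_lt (s := { r : ℝ | ∃ u : ℝ × ℝ → ℂ, C1Nhd u (OmegaEps Ω ε) ∧
        (0 < ∫ x in OmegaEps Ω ε, ‖u x‖ ^ 2) ∧
        r = (∫ x in OmegaEps Ω ε, mgNormSq H A u x) /
          (∫ x in OmegaEps Ω ε, ‖u x‖ ^ 2) })
      ⟨_, fun _ => 1, ⟨univ, isOpen_univ, subset_univ _, contDiffOn_const⟩, by simpa using hV, rfl⟩ h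
    rw [div_lt_iff₀ hN] at hr
    exact egs_lt Ω hΩo hΩb A hA hcurl κ ε H u hu hr
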